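/- arXiv:2110.00102 — 2 statements merged into one kernel-verified Lean document; each statement's English description precedes it below -/
import Mathlib

section
/- Let 𝔽_q be a finite field and let B ∈ 𝔽_q[T] be nonzero. There exists a constant C (depending on q and B) such that for every N ≥ 1 and every monic irreducible P ∈ 𝔽_q[T] with P ∤ B, writing m := deg(P): | #F_N(P·B) − #F_N(B) · ( 1 + ∑_{a=1}^{⌊N/m⌋} (−2/q^m)^a · (1 − a·m/N) ) | ≤ C · q^{N−m}. -/
open Polynomial UniqueFactorizationMonoid

/-- `D` is cube-free: no monic irreducible polynomial `P` satisfies `P³ ∣ D`. -/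
def Polynomial.CubeFree {Fq : Type*} [Field Fq] (D : Fq[X]) : Prop :=
  ∀ P : Fq[X], P.Monic → Irreducible P → ¬P ^ 3 ∣ D

/-- `deg(rad D)`: the sum of the degrees of the distinct monic irreducible divisors of `D`. -/
noncomputable def Polynomial.radDeg {Fq : Type*} [Field Fq] [DecidableEq Fq] (D : Fq[X]) : ℕ :=
  ∑ P ∈ (normalizedFactors D).toFinset, P.natDegree

/-- The family `F_N(B)`: monic cube-free polynomials coprime to `B` with
`deg(rad D) = N` and `3 ∣ deg D`. -/
def cubicTwistFamily {Fq : Type*} [Field Fq] [DecidableEq Fq] (B : Fq[X]) (N : ℕ) :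
    Set (Fq[X]) :=
  {D | D.Monic ∧ D.CubeFree ∧ IsCoprime D B ∧ D.radDeg = N ∧ 3 ∣ D.natDegree}


section Counting

variable {Fq : Type*} [Field Fq]

theorem monic_irreducible_dvd_imp_eq {P Q : Fq[X]} (hP : P.Monic) (hPi : Irreducible P)
    (hQ : Q.Monic) (hQi : Irreducible Q) (h : P ∣ Q) : P = Q :=
  eq_of_monic_of_associated hP hQ (hPi.associated_of_dvd hQi h)

theorem isCoprime_iff_not_dvd_of_irreducible {P D : Fq[X]} (hPi : Irreducible P) :
    IsCoprime D P ↔ ¬P ∣ D :=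
  isCoprime_comm.trans hPi.coprime_iff_not_dvd

theorem finite_setOf_natDegree_le [Finite Fq] (n : ℕ) : {f : Fq[X] | f.natDegree ≤ n}.Finite := by
  have : Finite (degreeLT Fq (n + 1)) := Finite.of_equiv _ (degreeLTEquiv Fq (n + 1)).symm.toEquiv
  refine (Set.toFinite ((degreeLT Fq (n + 1) : Set Fq[X]))).subset fun f hf => ?_
  simp only [SetLike.mem_coe, mem_degreeLT]
  refine lt_of_le_of_lt degree_le_natDegree ?_
  exact_mod_cast Nat.lt_succ_of_le hf

theorem ncard_monic_natDegree_eq [Fintype Fq] (n : ℕ) :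
    {f : Fq[X] | f.Monic ∧ f.natDegree = n}.ncard = Fintype.card Fq ^ n := by
  rw [← Nat.card_coe_set_eq, Nat.card_congr (show ({f : Fq[X] | f.Monic ∧ f.natDegree = n} ≃ _)
    from monicEquivDegreeLT n), Nat.card_congr (degreeLTEquiv Fq n).toEquiv]
  simp

theorem CubeFree.pow_mul_iff {P E : Fq[X]} (hP : P.Monic) (hPi : Irreducible P) (hE : ¬P ∣ E)
    {k : ℕ} (hk : k ≤ 2) : (P ^ k * E).CubeFree ↔ E.CubeFree := by
  refine ⟨fun h Q hQ hQi hd => h Q hQ hQi (hd.mul_left _), fun h Q hQ hQi hd => ?_⟩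
  by_cases hPQ : P = Q
  · subst hPQ
    have h3 : P ^ 3 = P ^ k * P ^ (3 - k) := by rw [← pow_add]; congr 1; omega
    rw [h3, mul_dvd_mul_iff_left (pow_ne_zero _ hP.ne_zero)] at hd
    exact hE ((dvd_pow_self P (by omega)).trans hd)
  · refine h Q hQ hQi (IsCoprime.dvd_of_dvd_mul_left (IsCoprime.pow ?_) hd)
    rw [isCoprime_iff_not_dvd_of_irreducible hPi]
    exact fun hd' => hPQ (monic_irreducible_dvd_imp_eq hP hPi hQ hQi hd')

/-- Monic polynomials of degree `n` coprime to `B`. -/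
def monicCoprimeSet (B : Fq[X]) (n : ℕ) : Set Fq[X] :=
  {f | f.Monic ∧ f.natDegree = n ∧ IsCoprime f B}

theorem finite_monicCoprimeSet [Finite Fq] (B : Fq[X]) (n : ℕ) : (monicCoprimeSet B n).Finite :=
  (finite_setOf_natDegree_le n).subset fun _ hf => hf.2.1.le

theorem mem_monicCoprimeSet_mul_iff {P B f : Fq[X]} (hPi : Irreducible P) {n : ℕ} :
    f ∈ monicCoprimeSet (P * B) n ↔ f ∈ monicCoprimeSet B n ∧ ¬P ∣ f := by
  simp only [monicCoprimeSet, Set.mem_ofPred_eq, IsCoprime.mul_right_iff,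
    isCoprime_iff_not_dvd_of_irreducible hPi]
  tauto

theorem monicCoprimeSet_mul_of_lt {P B : Fq[X]} (hPi : Irreducible P) {n : ℕ}
    (hn : n < P.natDegree) : monicCoprimeSet (P * B) n = monicCoprimeSet B n := by
  ext f
  rw [mem_monicCoprimeSet_mul_iff hPi, and_iff_left_iff_imp]
  intro hf hd
  have := natDegree_le_of_dvd hd hf.1.ne_zero
  rw [hf.2.1] at this
  omega

theorem monicCoprimeSet_add_natDegree {P B : Fq[X]} (hP : P.Monic) (hPi : Irreducible P)
    (hPB : ¬P ∣ B) (n : ℕ) :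
    monicCoprimeSet B (P.natDegree + n) = monicCoprimeSet (P * B) (P.natDegree + n) ∪
      (fun f => P * f) '' monicCoprimeSet B n := by
  ext f
  rw [Set.mem_union, mem_monicCoprimeSet_mul_iff hPi]
  have key : ∀ g : Fq[X], P * g ∈ monicCoprimeSet B (P.natDegree + n) ↔
      g ∈ monicCoprimeSet B n := by
    intro g
    simp only [monicCoprimeSet, Set.mem_ofPred_eq, IsCoprime.mul_left_iff,
      hPi.coprime_iff_not_dvd.mpr hPB, true_and]
    by_cases hg : g.Monic
    · simp [hg, hP.mul hg, hP.natDegree_mul hg]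
    · simp [hg, hP.of_mul_monic_left.mt hg]
  constructor
  · intro hf
    by_cases hd : P ∣ f
    · obtain ⟨g, rfl⟩ := hd
      exact Or.inr ⟨g, (key g).mp hf, rfl⟩
    · exact Or.inl ⟨hf, hd⟩
  · rintro (h | ⟨g, hg, rfl⟩)
    · exact h.1
    · exact (key g).mpr hg

theorem ncard_monicCoprimeSet_add_natDegree [Finite Fq] {P B : Fq[X]} (hP : P.Monic)
    (hPi : Irreducible P) (hPB : ¬P ∣ B) (n : ℕ) :
    (monicCoprimeSet B (P.natDegree + n)).ncard =
      (monicCoprimeSet (P * B) (P.natDegree + n)).ncard + (monicCoprimeSet B n).ncard := by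
  rw [monicCoprimeSet_add_natDegree hP hPi hPB, Set.ncard_union_eq _ (finite_monicCoprimeSet _ _)
    ((finite_monicCoprimeSet _ _).image _),
    Set.ncard_image_of_injective _ (mul_right_injective₀ hP.ne_zero)]
  rw [Set.disjoint_left]
  rintro _ hf ⟨g, _, rfl⟩
  exact ((mem_monicCoprimeSet_mul_iff hPi).mp hf).2 (dvd_mul_right _ _)

/-- The generating series counting monic polynomials coprime to `B`. -/
noncomputable def countSeries (B : Fq[X]) : PowerSeries ℂ :=
  PowerSeries.mk fun n => ((monicCoprimeSet B n).ncard : ℂ)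

theorem countSeries_mul [Finite Fq] {P B : Fq[X]} (hP : P.Monic)
    (hPi : Irreducible P) (hPB : ¬P ∣ B) :
    countSeries (P * B) = (1 - PowerSeries.X ^ P.natDegree) * countSeries B := by
  ext n
  rw [sub_mul, one_mul, map_sub, PowerSeries.coeff_X_pow_mul']
  simp only [countSeries, PowerSeries.coeff_mk]
  split_ifs with h
  · obtain ⟨k, rfl⟩ := Nat.exists_eq_add_of_le h
    rw [Nat.add_sub_cancel_left, ncard_monicCoprimeSet_add_natDegree hP hPi hPB k]
    push_cast
    ring
  · rw [sub_zero, monicCoprimeSet_mul_of_lt hPi (not_le.mp h)]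

theorem not_dvd_prod_mul {S : Finset Fq[X]} (hS : ∀ P ∈ S, P.Monic ∧ Irreducible P) {P B : Fq[X]}
    (hP : P.Monic) (hPi : Irreducible P) (hPS : P ∉ S) (hPB : ¬P ∣ B) :
    ¬P ∣ (∏ Q ∈ S, Q) * B := by
  intro h
  rcases hPi.prime.dvd_or_dvd h with h | h
  · obtain ⟨Q, hQ, hd⟩ := hPi.prime.exists_mem_finset_dvd h
    exact hPS (monic_irreducible_dvd_imp_eq hP hPi (hS Q hQ).1 (hS Q hQ).2 hd ▸ hQ)
  · exact hPB h

theorem countSeries_prod [Finite Fq] (S : Finset Fq[X])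
    (hS : ∀ P ∈ S, P.Monic ∧ Irreducible P) :
    countSeries (∏ P ∈ S, P) =
      (∏ P ∈ S, (1 - PowerSeries.X ^ P.natDegree)) * countSeries (1 : Fq[X]) := by
  classical
  induction S using Finset.induction_on with
  | empty => simp
  | insert P S hPS ih =>
    have hP := hS P (Finset.mem_insert_self _ _)
    have hS' := fun Q hQ => hS Q (Finset.mem_insert_of_mem hQ)
    have hnd := not_dvd_prod_mul hS' hP.1 hP.2 hPS hP.2.prime.not_dvd_one
    rw [mul_one] at hnd
    rw [Finset.prod_insert hPS, Finset.prod_insert hPS, countSeries_mul hP.1 hP.2 hnd, ih hS',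
      mul_assoc]

theorem countSeries_one_mul [Fintype Fq] :
    countSeries (1 : Fq[X]) * (1 - PowerSeries.C (Fintype.card Fq : ℂ) * PowerSeries.X) = 1 := by
  have h : ∀ n, (monicCoprimeSet (1 : Fq[X]) n).ncard = Fintype.card Fq ^ n := fun n => by
    rw [← ncard_monic_natDegree_eq, monicCoprimeSet]
    simp [isCoprime_one_right]
  ext n
  rw [mul_sub, mul_one, mul_left_comm, map_sub, PowerSeries.coeff_C_mul, PowerSeries.coeff_one]
  cases n with
  | zero => simp [countSeries, h]
  | succ n => 
    rw [PowerSeries.coeff_succ_mul_X]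
    simp [countSeries, h, pow_succ']

variable [DecidableEq Fq]

theorem radDeg_pow_mul {P E : Fq[X]} (hP : P.Monic) (hPi : Irreducible P) (hE0 : E ≠ 0)
    (hE : ¬P ∣ E) {k : ℕ} (hk : k ≠ 0) :
    (P ^ k * E).radDeg = P.natDegree + E.radDeg := by
  unfold Polynomial.radDeg
  rw [normalizedFactors_mul (pow_ne_zero _ hP.ne_zero) hE0, normalizedFactors_pow,
    normalizedFactors_irreducible hPi, hP.normalize_eq_self, Multiset.toFinset_add,
    Multiset.toFinset_nsmul _ _ hk, Multiset.toFinset_singleton, Finset.sum_union, 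
    Finset.sum_singleton]
  rw [Finset.disjoint_singleton_left, Multiset.mem_toFinset]
  exact fun h => hE (dvd_of_mem_normalizedFactors h)

theorem natDegree_le_radDeg {P D : Fq[X]} (hP : P.Monic) (hPi : Irreducible P) (hD : D ≠ 0)
    (h : P ∣ D) : P.natDegree ≤ D.radDeg := by
  refine Finset.single_le_sum (f := fun P : Fq[X] => P.natDegree) (fun _ _ => Nat.zero_le _) ?_
  rw [Multiset.mem_toFinset, mem_normalizedFactors_iff' hD]
  exact ⟨hPi, hP.normalize_eq_self, h⟩

theorem CubeFree.natDegree_le {D : Fq[X]} (hD : D.Monic) (h : D.CubeFree) :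
    D.natDegree ≤ 2 * D.radDeg := by
  have hp : (normalizedFactors D).prod = D := by
    rw [prod_normalizedFactors_eq hD.ne_zero, hD.normalize_eq_self]
  rw [Finset.prod_multiset_count] at hp
  have hmem : ∀ P ∈ (normalizedFactors D).toFinset, P.Monic ∧ Irreducible P ∧ P ∣ D := by
    intro P hP
    rw [Multiset.mem_toFinset, mem_normalizedFactors_iff' hD.ne_zero] at hP
    exact ⟨hP.2.1 ▸ monic_normalize hP.1.ne_zero, hP.1, hP.2.2⟩
  conv_lhs => rw [← hp]
  rw [natDegree_prod_of_monic _ _ fun P hP => (hmem P hP).1.pow _, Polynomial.radDeg,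
    Finset.mul_sum]
  refine Finset.sum_le_sum fun P hP => ?_
  rw [(hmem P hP).1.natDegree_pow]
  refine Nat.mul_le_mul_right _ (not_lt.mp fun hc => h P (hmem P hP).1 (hmem P hP).2.1 ?_)
  refine (pow_dvd_pow P (show 3 ≤ _ from hc)).trans ?_
  conv_rhs => rw [← hp]
  exact Finset.dvd_prod_of_mem (fun P => P ^ Multiset.count P (normalizedFactors D)) hP

/-- Monic cube-free polynomials coprime to `B` whose radical has degree `n`. -/
def cubeFreeFamily (B : Fq[X]) (n : ℕ) : Set Fq[X] :=
  {D | D.Monic ∧ D.CubeFree ∧ IsCoprime D B ∧ D.radDeg = n}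

theorem finite_cubeFreeFamily [Finite Fq] (B : Fq[X]) (n : ℕ) : (cubeFreeFamily B n).Finite :=
  (finite_setOf_natDegree_le (2 * n)).subset fun _ hD =>
    hD.2.2.2 ▸ CubeFree.natDegree_le hD.1 hD.2.1

theorem pow_mul_mem_cubeFreeFamily_iff {P B E : Fq[X]} (hP : P.Monic) (hPi : Irreducible P)
    (hPB : ¬P ∣ B) (hE : ¬P ∣ E) {k n : ℕ} (hk : k ≤ 2) (hk0 : k ≠ 0) :
    P ^ k * E ∈ cubeFreeFamily B (P.natDegree + n) ↔ E ∈ cubeFreeFamily (P * B) n := by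
  have hc : IsCoprime (P ^ k) B := (hPi.coprime_iff_not_dvd.mpr hPB).pow_left
  have hE' := (isCoprime_iff_not_dvd_of_irreducible hPi).mpr hE
  simp only [cubeFreeFamily, Set.mem_ofPred_eq, CubeFree.pow_mul_iff hP hPi hE hk,
    IsCoprime.mul_left_iff, IsCoprime.mul_right_iff, hc, hE', true_and]
  by_cases hm : E.Monic
  · simp [hm, (hP.pow k).mul hm, radDeg_pow_mul hP hPi hm.ne_zero hE hk0]
  · simp [hm, (hP.pow k).of_mul_monic_left.mt hm]

theorem mem_cubeFreeFamily_mul_iff {P B D : Fq[X]} (hPi : Irreducible P) {n : ℕ} :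
    D ∈ cubeFreeFamily (P * B) n ↔ D ∈ cubeFreeFamily B n ∧ ¬P ∣ D := by
  simp only [cubeFreeFamily, Set.mem_ofPred_eq, IsCoprime.mul_right_iff,
    isCoprime_iff_not_dvd_of_irreducible hPi]
  tauto

theorem cubeFreeFamily_mul_of_lt {P B : Fq[X]} (hP : P.Monic) (hPi : Irreducible P) {n : ℕ}
    (hn : n < P.natDegree) : cubeFreeFamily (P * B) n = cubeFreeFamily B n := by
  ext D
  rw [mem_cubeFreeFamily_mul_iff hPi, and_iff_left_iff_imp]
  intro hD hd
  have := natDegree_le_radDeg hP hPi hD.1.ne_zero hd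
  rw [hD.2.2.2] at this
  omega

theorem cubeFreeFamily_add_natDegree {P B : Fq[X]} (hP : P.Monic) (hPi : Irreducible P)
    (hPB : ¬P ∣ B) (n : ℕ) :
    cubeFreeFamily B (P.natDegree + n) = cubeFreeFamily (P * B) (P.natDegree + n) ∪
      ((fun E => P ^ 1 * E) '' cubeFreeFamily (P * B) n ∪
        (fun E => P ^ 2 * E) '' cubeFreeFamily (P * B) n) := by
  have key : ∀ {k : ℕ}, k ≤ 2 → k ≠ 0 → ∀ E ∈ cubeFreeFamily (P * B) n,
      P ^ k * E ∈ cubeFreeFamily B (P.natDegree + n) := fun hk hk0 E hE =>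
    (pow_mul_mem_cubeFreeFamily_iff hP hPi hPB ((mem_cubeFreeFamily_mul_iff hPi).mp hE).2
      hk hk0).mpr hE
  refine Set.Subset.antisymm (fun D hD => ?_) (Set.union_subset
    (fun D hD => ((mem_cubeFreeFamily_mul_iff hPi).mp hD).1) (Set.union_subset ?_ ?_))
  · obtain ⟨k, E, hE, rfl⟩ := WfDvdMonoid.max_power_factor hD.1.ne_zero hPi
    have hk : k ≤ 2 := not_lt.mp fun hc =>
      hD.2.1 P hP hPi ((pow_dvd_pow P (show 3 ≤ k from hc)).mul_right E)
    rcases Nat.eq_zero_or_pos k with rfl | hk0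
    · left
      rw [pow_zero, one_mul] at hD ⊢
      exact (mem_cubeFreeFamily_mul_iff hPi).mpr ⟨hD, hE⟩
    · right
      have := (pow_mul_mem_cubeFreeFamily_iff hP hPi hPB hE hk hk0.ne').mp hD
      interval_cases k
      · exact Or.inl ⟨E, this, rfl⟩
      · exact Or.inr ⟨E, this, rfl⟩
  · rintro _ ⟨E, hE, rfl⟩
    exact key (by norm_num) (by norm_num) E hE
  · rintro _ ⟨E, hE, rfl⟩
    exact key le_rfl (by norm_num) E hE

/-- The sum of `χ ^ deg D` over the monic cube-free `D` coprime to `B` with `deg (rad D) = n`. -/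
noncomputable def twistSum (χ : ℂ) (B : Fq[X]) (n : ℕ) : ℂ :=
  ∑ᶠ D ∈ cubeFreeFamily B n, χ ^ D.natDegree

theorem twistSum_mul_of_lt (χ : ℂ) {P B : Fq[X]} (hP : P.Monic) (hPi : Irreducible P) {n : ℕ}
    (hn : n < P.natDegree) : twistSum χ (P * B) n = twistSum χ B n := by
  rw [twistSum, twistSum, cubeFreeFamily_mul_of_lt hP hPi hn]

theorem twistSum_add_natDegree [Finite Fq] (χ : ℂ) {P B : Fq[X]} (hP : P.Monic)
    (hPi : Irreducible P) (hPB : ¬P ∣ B) (n : ℕ) :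
    twistSum χ B (P.natDegree + n) = twistSum χ (P * B) (P.natDegree + n) +
      (χ ^ P.natDegree + χ ^ (2 * P.natDegree)) * twistSum χ (P * B) n := by
  have hinj : ∀ k : ℕ, Function.Injective (fun E : Fq[X] => P ^ k * E) := fun k =>
    mul_right_injective₀ (pow_ne_zero k hP.ne_zero)
  have himg : ∀ k : ℕ, ∑ᶠ D ∈ (fun E => P ^ k * E) '' cubeFreeFamily (P * B) n, χ ^ D.natDegree =
      χ ^ (k * P.natDegree) * twistSum χ (P * B) n := by
    intro k
    rw [finsum_mem_image (hinj k).injOn, twistSum, mul_finsum_mem]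
    refine finsum_mem_congr rfl fun E hE => ?_
    rw [(hP.pow k).natDegree_mul hE.1, hP.natDegree_pow, pow_add]
  have hfin : ∀ k : ℕ, ((fun E => P ^ k * E) '' cubeFreeFamily (P * B) n).Finite := fun k =>
    (finite_cubeFreeFamily _ _).image _
  have hndvd : ∀ {E : Fq[X]} {j : ℕ}, E ∈ cubeFreeFamily (P * B) j → ¬P ∣ E := fun hE =>
    ((mem_cubeFreeFamily_mul_iff hPi).mp hE).2
  rw [twistSum, cubeFreeFamily_add_natDegree hP hPi hPB, finsum_mem_union _
    (finite_cubeFreeFamily _ _) ((hfin 1).union (hfin 2)), finsum_mem_union _ (hfin 1) (hfin 2),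
    himg, himg, one_mul, add_mul, twistSum, twistSum]
  · rw [Set.disjoint_left]
    rintro _ ⟨E, hE, rfl⟩ ⟨E', hE', h⟩
    refine hndvd hE ⟨E', ?_⟩
    refine mul_left_cancel₀ hP.ne_zero ?_
    linear_combination -h
  · rw [Set.disjoint_left]
    rintro _ hD (⟨E, hE, rfl⟩ | ⟨E, hE, rfl⟩)
    · exact hndvd hD (Dvd.intro E (by ring))
    · exact hndvd hD (Dvd.intro (P * E) (by ring))

/-- The generating series of `twistSum χ B`. -/
noncomputable def twistSeries (χ : ℂ) (B : Fq[X]) : PowerSeries ℂ :=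
  PowerSeries.mk (twistSum χ B)

theorem twistSeries_eq_mul [Finite Fq] (χ : ℂ) {P B : Fq[X]} (hP : P.Monic)
    (hPi : Irreducible P) (hPB : ¬P ∣ B) :
    twistSeries χ B = (1 + PowerSeries.C (χ ^ P.natDegree + χ ^ (2 * P.natDegree)) *
      PowerSeries.X ^ P.natDegree) * twistSeries χ (P * B) := by
  ext n
  rw [add_mul, one_mul, mul_assoc, map_add, PowerSeries.coeff_C_mul,
    PowerSeries.coeff_X_pow_mul']
  simp only [twistSeries, PowerSeries.coeff_mk]
  split_ifs with h
  · obtain ⟨k, rfl⟩ := Nat.exists_eq_add_of_le h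
    rw [Nat.add_sub_cancel_left]
    exact twistSum_add_natDegree χ hP hPi hPB k
  · rw [mul_zero, add_zero, twistSum_mul_of_lt χ hP hPi (not_le.mp h)]

theorem twistSeries_eq_prod_mul [Finite Fq] (χ : ℂ) (B : Fq[X]) (S : Finset Fq[X])
    (hS : ∀ P ∈ S, P.Monic ∧ Irreducible P) (hSB : ∀ P ∈ S, ¬P ∣ B) :
    twistSeries χ B = (∏ P ∈ S, (1 + PowerSeries.C (χ ^ P.natDegree + χ ^ (2 * P.natDegree)) *
      PowerSeries.X ^ P.natDegree)) * twistSeries χ ((∏ P ∈ S, P) * B) := by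
  induction S using Finset.induction_on with
  | empty => simp
  | insert P S hPS ih =>
    have hP := hS P (Finset.mem_insert_self _ _)
    have hS' := fun Q hQ => hS Q (Finset.mem_insert_of_mem hQ)
    rw [ih hS' fun Q hQ => hSB Q (Finset.mem_insert_of_mem hQ), twistSeries_eq_mul χ hP.1 hP.2
      (not_dvd_prod_mul hS' hP.1 hP.2 hPS (hSB P (Finset.mem_insert_self _ _))),
      Finset.prod_insert hPS, Finset.prod_insert hPS, mul_assoc P]
    ring

theorem exists_monic_irreducible_dvd {f : Fq[X]} (hf : f.Monic) (h : f ≠ 1) :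
    ∃ P : Fq[X], P.Monic ∧ Irreducible P ∧ P ∣ f := by
  obtain ⟨P, hPi, hd⟩ := WfDvdMonoid.exists_irreducible_factor (mt hf.eq_one_of_isUnit h)
    hf.ne_zero
  exact ⟨normalize P, monic_normalize hPi.ne_zero,
    (normalize_associated P).symm.irreducible hPi, normalize_dvd_iff.mpr hd⟩

theorem X_pow_dvd_twistSeries_sub_one (χ : ℂ) {B : Fq[X]} {M : ℕ}
    (hB : ∀ P : Fq[X], P.Monic → Irreducible P → P.natDegree ≤ M → P ∣ B) :
    PowerSeries.X ^ (M + 1) ∣ twistSeries χ B - 1 := by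
  rw [PowerSeries.X_pow_dvd_iff]
  intro n hn
  have h1 : ∀ D ∈ cubeFreeFamily B n, D = 1 := by
    intro D hD
    by_contra hne
    obtain ⟨P, hP, hPi, hd⟩ := exists_monic_irreducible_dvd hD.1 hne
    have hle := natDegree_le_radDeg hP hPi hD.1.ne_zero hd
    rw [hD.2.2.2] at hle
    exact hPi.not_isUnit (hD.2.2.1.isUnit_of_dvd' hd (hB P hP hPi (by omega)))
  have hrad : (1 : Fq[X]).radDeg = 0 := by simp [Polynomial.radDeg]
  rw [map_sub, PowerSeries.coeff_one, twistSeries, PowerSeries.coeff_mk, twistSum]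
  split_ifs with h0
  · have : cubeFreeFamily B n = {1} := by
      refine Set.Subset.antisymm (fun D hD => h1 D hD) ?_
      rintro _ rfl
      refine ⟨monic_one, fun P hP hPi hd => ?_, isCoprime_one_left, h0 ▸ hrad⟩
      exact hPi.prime.not_dvd_one ((dvd_pow_self P (by norm_num)).trans hd)
    rw [this, finsum_mem_singleton]
    simp
  · have : cubeFreeFamily B n = ∅ := by
      refine Set.eq_empty_of_forall_notMem fun D hD => ?_
      have := hD.2.2.2
      rw [h1 D hD, hrad] at this
      exact h0 this.symm
    rw [this, finsum_mem_empty, sub_zero]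

theorem X_pow_dvd_countSeries_sub_one {B : Fq[X]} {M : ℕ}
    (hB : ∀ P : Fq[X], P.Monic → Irreducible P → P.natDegree ≤ M → P ∣ B) :
    PowerSeries.X ^ (M + 1) ∣ countSeries B - 1 := by
  rw [PowerSeries.X_pow_dvd_iff]
  intro n hn
  have h1 : ∀ f ∈ monicCoprimeSet B n, f = 1 := by
    intro f hf
    by_contra hne
    obtain ⟨P, hP, hPi, hd⟩ := exists_monic_irreducible_dvd hf.1 hne
    have hle := natDegree_le_of_dvd hd hf.1.ne_zero
    rw [hf.2.1] at hle
    exact hPi.not_isUnit (hf.2.2.isUnit_of_dvd' hd (hB P hP hPi (by omega)))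
  rw [map_sub, PowerSeries.coeff_one, countSeries, PowerSeries.coeff_mk]
  split_ifs with h0
  · have : monicCoprimeSet B n = {1} := by
      refine Set.Subset.antisymm (fun f hf => h1 f hf) ?_
      rintro _ rfl
      exact ⟨monic_one, h0 ▸ natDegree_one, isCoprime_one_left⟩
    simp [this]
  · have : monicCoprimeSet B n = ∅ := by
      refine Set.eq_empty_of_forall_notMem fun f hf => ?_
      have := hf.2.1
      rw [h1 f hf, natDegree_one] at this
      exact h0 this.symm
    simp [this]

end Counting

section TruncNorm

/-- The weighted `ℓ¹` norm of the coefficients of `f` of index at most `M`. -/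
noncomputable def truncNorm (M : ℕ) (t : ℝ) (f : PowerSeries ℂ) : ℝ :=
  ∑ k ∈ Finset.range (M + 1), ‖PowerSeries.coeff k f‖ * t ^ k

variable {M : ℕ} {t : ℝ}

theorem truncNorm_nonneg (ht : 0 ≤ t) (f : PowerSeries ℂ) : 0 ≤ truncNorm M t f :=
  Finset.sum_nonneg fun _ _ => by positivity

theorem truncNorm_congr {f g : PowerSeries ℂ} (h : PowerSeries.X ^ (M + 1) ∣ f - g) :
    truncNorm M t f = truncNorm M t g := by
  refine Finset.sum_congr rfl fun k hk => ?_
  have := PowerSeries.X_pow_dvd_iff.mp h k (Finset.mem_range.mp hk)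
  rw [map_sub, sub_eq_zero] at this
  rw [this]

theorem truncNorm_add_le (ht : 0 ≤ t) (f g : PowerSeries ℂ) :
    truncNorm M t (f + g) ≤ truncNorm M t f + truncNorm M t g := by
  rw [truncNorm, truncNorm, truncNorm, ← Finset.sum_add_distrib]
  refine Finset.sum_le_sum fun k _ => ?_
  rw [← add_mul, map_add]
  gcongr
  exact norm_add_le _ _

theorem truncNorm_C_mul_X_pow_le (ht : 0 ≤ t) (a : ℂ) (n : ℕ) :
    truncNorm M t (PowerSeries.C a * PowerSeries.X ^ n) ≤ ‖a‖ * t ^ n := by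
  have : ∀ k, ‖PowerSeries.coeff k (PowerSeries.C a * PowerSeries.X ^ n)‖ * t ^ k =
      if k = n then ‖a‖ * t ^ n else 0 := fun k => by
    rw [PowerSeries.coeff_C_mul, PowerSeries.coeff_X_pow]
    split_ifs with h <;> simp [h]
  rw [truncNorm, Finset.sum_congr rfl fun k _ => this k, Finset.sum_ite_eq']
  split_ifs
  · exact le_rfl
  · positivity

theorem truncNorm_one_le (ht : 0 ≤ t) : truncNorm M t 1 ≤ 1 := by
  simpa using truncNorm_C_mul_X_pow_le (M := M) ht 1 0

theorem truncNorm_mul_le (ht : 0 ≤ t) (f g : PowerSeries ℂ) :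
    truncNorm M t (f * g) ≤ truncNorm M t f * truncNorm M t g := by
  set F : ℕ × ℕ → ℝ := fun p =>
    (‖PowerSeries.coeff p.1 f‖ * t ^ p.1) * (‖PowerSeries.coeff p.2 g‖ * t ^ p.2)
  have hF : ∀ p, 0 ≤ F p := fun p => by positivity
  set R := Finset.range (M + 1) ×ˢ Finset.range (M + 1)
  calc truncNorm M t (f * g)
      ≤ ∑ k ∈ Finset.range (M + 1), ∑ p ∈ R with p.1 + p.2 = k, F p := by
        refine Finset.sum_le_sum fun k hk => ?_
        have hk' := Finset.mem_range.mp hk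
        calc ‖PowerSeries.coeff k (f * g)‖ * t ^ k
            ≤ (∑ p ∈ Finset.HasAntidiagonal.antidiagonal k,
                ‖PowerSeries.coeff p.1 f * PowerSeries.coeff p.2 g‖) * t ^ k := by
              rw [PowerSeries.coeff_mul]
              gcongr
              exact norm_sum_le _ _
          _ = ∑ p ∈ Finset.HasAntidiagonal.antidiagonal k, F p := by
              rw [Finset.sum_mul]
              refine Finset.sum_congr rfl fun p hp => ?_
              rw [norm_mul, ← Finset.HasAntidiagonal.mem_antidiagonal.mp hp, pow_add]
              simp only [F]
              ring
          _ ≤ _ := by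
              refine Finset.sum_le_sum_of_subset_of_nonneg (fun p hp => ?_) fun p _ _ => hF p
              have := Finset.HasAntidiagonal.mem_antidiagonal.mp hp
              simp only [R, Finset.mem_filter, Finset.mem_product, Finset.mem_range]
              omega
    _ ≤ ∑ p ∈ R, F p :=
        Finset.sum_fiberwise_le_sum_of_sum_fiber_nonneg fun _ _ =>
          Finset.sum_nonneg fun p _ => hF p
    _ = truncNorm M t f * truncNorm M t g := by
        rw [truncNorm, truncNorm, Finset.sum_mul_sum, Finset.sum_product]

theorem truncNorm_prod_le {ι : Type*} (ht : 0 ≤ t) (s : Finset ι) (f : ι → PowerSeries ℂ) :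
    truncNorm M t (∏ i ∈ s, f i) ≤ ∏ i ∈ s, truncNorm M t (f i) := by
  classical
  induction s using Finset.induction_on with
  | empty => simpa using truncNorm_one_le ht
  | insert i s hi ih =>
    rw [Finset.prod_insert hi, Finset.prod_insert hi]
    exact (truncNorm_mul_le ht _ _).trans
      (mul_le_mul_of_nonneg_left ih (truncNorm_nonneg ht _))

end TruncNorm

section EulerProduct

variable {Fq : Type*} [Field Fq] [Fintype Fq]

theorem finite_setOf_monic_irreducible (M : ℕ) :
    {P : Fq[X] | P.Monic ∧ Irreducible P ∧ P.natDegree ≤ M}.Finite :=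
  (finite_setOf_natDegree_le M).subset fun _ hP => hP.2.2

theorem sum_pow_natDegree_le {M : ℕ} {s : ℝ} (hs : 0 ≤ s) (hs1 : (Fintype.card Fq : ℝ) * s < 1)
    (S : Finset Fq[X]) (hS : ∀ P ∈ S, P.Monic ∧ P.natDegree ≤ M) :
    ∑ P ∈ S, s ^ P.natDegree ≤ (1 - (Fintype.card Fq : ℝ) * s)⁻¹ := by
  classical
  have hqs : 0 ≤ (Fintype.card Fq : ℝ) * s := by positivity
  rw [← Finset.sum_fiberwise_of_maps_to (t := Finset.range (M + 1)) (g := natDegree)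
    fun P hP => Finset.mem_range.mpr (Nat.lt_succ_of_le (hS P hP).2)]
  calc ∑ n ∈ Finset.range (M + 1), ∑ P ∈ S with P.natDegree = n, s ^ P.natDegree
      ≤ ∑ n ∈ Finset.range (M + 1), ((Fintype.card Fq : ℝ) * s) ^ n := by
        refine Finset.sum_le_sum fun n _ => ?_
        have hcard : (S.filter fun P => P.natDegree = n).card ≤ Fintype.card Fq ^ n := by
          rw [← ncard_monic_natDegree_eq, ← Set.ncard_coe_finset]
          refine Set.ncard_le_ncard (fun P hP => ?_)
            ((finite_setOf_natDegree_le n).subset fun _ hf => hf.2.le)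
          rw [Finset.mem_coe, Finset.mem_filter] at hP
          exact ⟨(hS P hP.1).1, hP.2⟩
        rw [Finset.sum_congr rfl fun P hP => by rw [(Finset.mem_filter.mp hP).2],
          Finset.sum_const, nsmul_eq_mul, mul_pow]
        gcongr
        exact_mod_cast hcard
    _ ≤ (1 - (Fintype.card Fq : ℝ) * s)⁻¹ := by
        rw [← tsum_geometric_of_lt_one hqs hs1]
        exact (summable_geometric_of_lt_one hqs hs1).sum_le_tsum _ fun _ _ => by positivity

theorem rescale_one_sub_X_pow (χ : ℂ) (m : ℕ) :
    PowerSeries.rescale χ (1 - PowerSeries.X ^ m) =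
      1 - PowerSeries.C (χ ^ m) * PowerSeries.X ^ m := by
  rw [map_sub, map_one, map_pow, PowerSeries.rescale_X, mul_pow, ← map_pow]

theorem rescale_countSeries_prod_mul (χ : ℂ) (S : Finset Fq[X])
    (hS : ∀ P ∈ S, P.Monic ∧ Irreducible P) :
    PowerSeries.rescale χ (countSeries (∏ P ∈ S, P)) *
        (1 - PowerSeries.C (χ * Fintype.card Fq) * PowerSeries.X) =
      ∏ P ∈ S, (1 - PowerSeries.C (χ ^ P.natDegree) * PowerSeries.X ^ P.natDegree) := by
  have h : countSeries (∏ P ∈ S, P) *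
      (1 - PowerSeries.C (Fintype.card Fq : ℂ) * PowerSeries.X) =
      ∏ P ∈ S, (1 - PowerSeries.X ^ P.natDegree) := by
    rw [countSeries_prod S hS, mul_assoc, countSeries_one_mul, mul_one]
  have h2 := congrArg (PowerSeries.rescale χ) h
  rw [map_mul, map_prod, map_sub, map_one, map_mul, PowerSeries.rescale_X,
    show PowerSeries.rescale χ (PowerSeries.C (Fintype.card Fq : ℂ)) =
      PowerSeries.C (Fintype.card Fq : ℂ) by simp, ← mul_assoc, ← map_mul, mul_comm _ χ] at h2
  simpa only [rescale_one_sub_X_pow] using h2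

theorem X_pow_dvd_rescale_sub_one {f : PowerSeries ℂ} {M : ℕ} (χ : ℂ)
    (h : PowerSeries.X ^ M ∣ f - 1) : PowerSeries.X ^ M ∣ PowerSeries.rescale χ f - 1 := by
  rw [PowerSeries.X_pow_dvd_iff] at h ⊢
  intro n hn
  rw [← map_one (PowerSeries.rescale χ), ← map_sub, PowerSeries.coeff_rescale, h n hn, mul_zero]

theorem truncNorm_local_factor_le {M : ℕ} {t : ℝ} (ht : 0 ≤ t) (ht1 : t ≤ 1) {χ : ℂ}
    (hχ : χ ^ 3 = 1) (m : ℕ) :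
    truncNorm M t ((1 + PowerSeries.C (χ ^ m + χ ^ (2 * m)) * PowerSeries.X ^ m) *
      ((1 - PowerSeries.C (χ ^ m) * PowerSeries.X ^ m) *
        (1 - PowerSeries.C ((χ ^ 2) ^ m) * PowerSeries.X ^ m))) ≤ 1 + 7 * (t ^ 2) ^ m := by
  have hn : ‖χ‖ = 1 := Complex.norm_eq_one_of_pow_eq_one hχ (by norm_num)
  have h3 : χ ^ m * χ ^ (2 * m) = 1 := by rw [← pow_add, ← one_add_mul, pow_mul]; simp [hχ]
  set a := χ ^ m with ha
  set b := χ ^ (2 * m) with hb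
  have hna : ‖a‖ = 1 := by simp [ha, hn]
  have hnb : ‖b‖ = 1 := by simp [hb, hn]
  have hC : (PowerSeries.C a * PowerSeries.C b : PowerSeries ℂ) = 1 := by
    rw [← map_mul, h3, map_one]
  have heq : (1 + PowerSeries.C (a + b) * PowerSeries.X ^ m) *
      ((1 - PowerSeries.C a * PowerSeries.X ^ m) *
        (1 - PowerSeries.C ((χ ^ 2) ^ m) * PowerSeries.X ^ m)) =
      1 + (PowerSeries.C (1 - (a + b) ^ 2) * PowerSeries.X ^ (2 * m) +
        PowerSeries.C (a + b) * PowerSeries.X ^ (3 * m)) := by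
    rw [← pow_mul χ 2 m, ← hb, map_sub PowerSeries.C, map_pow PowerSeries.C (a + b),
      map_add PowerSeries.C, map_one, mul_comm 2 m, mul_comm 3 m, pow_mul, pow_mul]
    linear_combination (PowerSeries.X ^ m) ^ 2 * (1 + (PowerSeries.C a + PowerSeries.C b) *
      PowerSeries.X ^ m) * hC
  have hab : ‖a + b‖ ≤ 2 := (norm_add_le _ _).trans (by rw [hna, hnb]; norm_num)
  have hab2 : ‖1 - (a + b) ^ 2‖ ≤ 5 := by
    refine (norm_sub_le _ _).trans ?_
    rw [norm_one, norm_pow]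
    nlinarith [norm_nonneg (a + b)]
  rw [heq]
  refine (truncNorm_add_le ht _ _).trans (add_le_add (truncNorm_one_le ht)
    ((truncNorm_add_le ht _ _).trans ((add_le_add (truncNorm_C_mul_X_pow_le ht _ _)
      (truncNorm_C_mul_X_pow_le ht _ _)).trans ?_)))
  have h23 : t ^ (3 * m) ≤ t ^ (2 * m) := pow_le_pow_of_le_one ht ht1 (by omega)
  have h2 : 0 ≤ t ^ (2 * m) := by positivity
  have h30 : 0 ≤ t ^ (3 * m) := by positivity
  rw [← pow_mul]
  nlinarith

theorem truncNorm_one_sub_le {M : ℕ} {t : ℝ} (ht : 0 ≤ t) (ht1 : t ≤ 1) {a : ℂ}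
    (ha : ‖a‖ = 1) (m : ℕ) :
    truncNorm M t (1 - PowerSeries.C a * PowerSeries.X ^ m) ≤ 2 := by
  have h := (truncNorm_add_le (M := M) ht 1 (PowerSeries.C (-a) * PowerSeries.X ^ m)).trans
    (add_le_add (truncNorm_one_le ht) (truncNorm_C_mul_X_pow_le ht _ _))
  rw [norm_neg, ha, one_mul, map_neg, neg_mul, ← sub_eq_add_neg] at h
  linarith [pow_le_one₀ (n := m) ht ht1]

variable [DecidableEq Fq]

/-- The quotient of `twistSeries χ B` by the two zeta factors that carry its poles. -/
noncomputable def reducedSeries (χ : ℂ) (B : Fq[X]) : PowerSeries ℂ :=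
  twistSeries χ B * ((1 - PowerSeries.C (χ * Fintype.card Fq) * PowerSeries.X) *
    (1 - PowerSeries.C (χ ^ 2 * Fintype.card Fq) * PowerSeries.X))

theorem truncNorm_reducedSeries_le {B : Fq[X]} (hB : B ≠ 0) {χ : ℂ} (hχ : χ ^ 3 = 1) {t : ℝ}
    (ht : 0 ≤ t) (ht1 : t ≤ 1) (hqt : (Fintype.card Fq : ℝ) * t ^ 2 < 1) :
    ∃ K : ℝ, ∀ M, truncNorm M t (reducedSeries χ B) ≤ K := by
  classical
  refine ⟨Real.exp (7 * (1 - (Fintype.card Fq : ℝ) * t ^ 2)⁻¹) *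
    4 ^ (normalizedFactors B).toFinset.card, fun M => ?_⟩
  have hn : ‖χ‖ = 1 := Complex.norm_eq_one_of_pow_eq_one hχ (by norm_num)
  set S := (finite_setOf_monic_irreducible (Fq := Fq) M).toFinset with hSdef
  have hSmem : ∀ P, P ∈ S ↔ P.Monic ∧ Irreducible P ∧ P.natDegree ≤ M := fun P => by
    simp [hSdef]
  have hS : ∀ P ∈ S, P.Monic ∧ Irreducible P := fun P hP =>
    ⟨((hSmem P).mp hP).1, ((hSmem P).mp hP).2.1⟩
  set S₁ := S.filter fun P => ¬P ∣ B with hS₁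
  set S₂ := S.filter fun P => P ∣ B with hS₂
  have hprod : ∀ f : Fq[X] → PowerSeries ℂ,
      ∏ P ∈ S, f P = (∏ P ∈ S₂, f P) * ∏ P ∈ S₁, f P := fun f =>
    (Finset.prod_filter_mul_prod_filter_not S _ f).symm
  set G := twistSeries χ ((∏ P ∈ S₁, P) * B) with hG
  have hG1 : PowerSeries.X ^ (M + 1) ∣ G - 1 := by
    refine X_pow_dvd_twistSeries_sub_one χ fun P hP hPi hle => ?_
    by_cases hd : P ∣ B
    · exact hd.mul_left _
    · exact (Finset.dvd_prod_of_mem _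
        (Finset.mem_filter.mpr ⟨(hSmem P).mpr ⟨hP, hPi, hle⟩, hd⟩)).mul_right _
  have hZ1 : PowerSeries.X ^ (M + 1) ∣ countSeries (∏ P ∈ S, P) - 1 :=
    X_pow_dvd_countSeries_sub_one fun P hP hPi hle =>
      Finset.dvd_prod_of_mem _ ((hSmem P).mpr ⟨hP, hPi, hle⟩)
  set Z := PowerSeries.rescale χ (countSeries (∏ P ∈ S, P)) with hZ
  set Z' := PowerSeries.rescale (χ ^ 2) (countSeries (∏ P ∈ S, P)) with hZ'
  have hZZ : PowerSeries.X ^ (M + 1) ∣ Z * Z' - 1 := by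
    have h1 := X_pow_dvd_rescale_sub_one χ hZ1
    have h2 := X_pow_dvd_rescale_sub_one (χ ^ 2) hZ1
    have : Z * Z' - 1 = (Z - 1) * Z' + (Z' - 1) := by ring
    rw [this]
    exact dvd_add (h1.mul_right _) h2
  have hfact : reducedSeries χ B * (Z * Z') = G *
      ((∏ P ∈ S₁, ((1 + PowerSeries.C (χ ^ P.natDegree + χ ^ (2 * P.natDegree)) *
        PowerSeries.X ^ P.natDegree) *
        ((1 - PowerSeries.C (χ ^ P.natDegree) * PowerSeries.X ^ P.natDegree) *
        (1 - PowerSeries.C ((χ ^ 2) ^ P.natDegree) * PowerSeries.X ^ P.natDegree)))) *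
      ∏ P ∈ S₂, ((1 - PowerSeries.C (χ ^ P.natDegree) * PowerSeries.X ^ P.natDegree) *
        (1 - PowerSeries.C ((χ ^ 2) ^ P.natDegree) * PowerSeries.X ^ P.natDegree))) := by
    have e1 := rescale_countSeries_prod_mul χ S hS
    have e2 := rescale_countSeries_prod_mul (χ ^ 2) S hS
    rw [← hZ, hprod] at e1
    rw [← hZ', hprod] at e2
    have e3 := twistSeries_eq_prod_mul χ B S₁
      (fun P hP => hS P (Finset.mem_filter.mp hP).1) fun P hP => (Finset.mem_filter.mp hP).2
    rw [← hG] at e3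
    rw [reducedSeries, e3]
    simp only [Finset.prod_mul_distrib]
    linear_combination (exp := 1) G * (∏ P ∈ S₁, (1 + PowerSeries.C
      (χ ^ P.natDegree + χ ^ (2 * P.natDegree)) * PowerSeries.X ^ P.natDegree)) *
      (Z' * (1 - PowerSeries.C (χ ^ 2 * Fintype.card Fq) * PowerSeries.X) * e1 +
        (∏ P ∈ S₂, (1 - PowerSeries.C (χ ^ P.natDegree) * PowerSeries.X ^ P.natDegree)) *
        (∏ P ∈ S₁, (1 - PowerSeries.C (χ ^ P.natDegree) * PowerSeries.X ^ P.natDegree)) * e2)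
  have hcongr : truncNorm M t (reducedSeries χ B) =
      truncNorm M t (reducedSeries χ B * (Z * Z')) := by
    refine (truncNorm_congr ?_).symm
    rw [← mul_sub_one]
    exact hZZ.mul_left _
  rw [hcongr, hfact]
  refine (truncNorm_mul_le ht _ _).trans ?_
  rw [truncNorm_congr hG1]
  refine (mul_le_of_le_one_left (truncNorm_nonneg ht _) (truncNorm_one_le ht)).trans ?_
  refine (truncNorm_mul_le ht _ _).trans ?_
  refine mul_le_mul ?_ ?_ (truncNorm_nonneg ht _) (Real.exp_pos _).le
  · refine (truncNorm_prod_le ht _ _).trans ?_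
    have h1 := Finset.prod_le_prod (s := S₁) (fun P _ => truncNorm_nonneg ht _)
      fun P _ => truncNorm_local_factor_le (M := M) ht ht1 hχ P.natDegree
    refine h1.trans ?_
    have h2 := Real.prod_one_add_le_exp_sum S₁ (f := fun P => 7 * (t ^ 2) ^ P.natDegree)
      fun P => by positivity
    refine h2.trans (Real.exp_le_exp.mpr ?_)
    rw [← Finset.mul_sum]
    refine mul_le_mul_of_nonneg_left (sum_pow_natDegree_le (M := M) (by positivity) hqt _ ?_)
      (by norm_num)
    intro P hP
    have := (hSmem P).mp (Finset.mem_filter.mp hP).1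
    exact ⟨this.1, this.2.2⟩
  · refine (truncNorm_prod_le ht _ _).trans ?_
    have h1 := Finset.prod_le_prod (s := S₂) (fun P _ => truncNorm_nonneg ht _) fun P _ =>
      (truncNorm_mul_le (M := M) ht _ _).trans (mul_le_mul
        (truncNorm_one_sub_le ht ht1 (a := χ ^ P.natDegree) (by simp [hn]) P.natDegree)
        (truncNorm_one_sub_le ht ht1 (a := (χ ^ 2) ^ P.natDegree) (by simp [hn]) P.natDegree)
        (truncNorm_nonneg ht _) (by norm_num))
    refine h1.trans ?_
    rw [Finset.prod_const, show (2 * 2 : ℝ) = 4 by norm_num]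
    refine pow_le_pow_right₀ (by norm_num) (Finset.card_le_card fun P hP => ?_)
    have h := Finset.mem_filter.mp hP
    rw [Multiset.mem_toFinset, mem_normalizedFactors_iff' hB]
    exact ⟨(hS P h.1).2, (hS P h.1).1.normalize_eq_self, h.2⟩

theorem exists_norm_coeff_reducedSeries_le {B : Fq[X]} (hB : B ≠ 0) {χ : ℂ} (hχ : χ ^ 3 = 1) :
    ∃ K : ℝ, 0 ≤ K ∧ ∀ n, ‖PowerSeries.coeff n (reducedSeries χ B)‖ ≤
      K * (3 / 4 : ℝ) ^ n * (Fintype.card Fq : ℝ) ^ n := by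
  have hq : (2 : ℝ) ≤ Fintype.card Fq := by exact_mod_cast Fintype.one_lt_card (α := Fq)
  set q : ℝ := (Fintype.card Fq : ℝ) with hqdef
  have hq0 : 0 < q := by linarith
  obtain ⟨K, hK⟩ := truncNorm_reducedSeries_le hB hχ (t := 4 / (3 * q)) (by positivity)
    (by rw [div_le_one (by positivity)]; linarith)
    (by rw [div_pow, mul_div_assoc', div_lt_one (by positivity)]; nlinarith)
  refine ⟨K, (truncNorm_nonneg (by positivity) _).trans (hK 0), fun n => ?_⟩
  have h1 := (Finset.single_le_sum
    (f := fun k => ‖PowerSeries.coeff k (reducedSeries χ B)‖ * (4 / (3 * q)) ^ k)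
    (fun k _ => by positivity) (Finset.self_mem_range_succ n)).trans (hK n)
  have h2 : (4 / (3 * q)) * (3 / 4 * q) = 1 := by field_simp
  calc ‖PowerSeries.coeff n (reducedSeries χ B)‖
      = ‖PowerSeries.coeff n (reducedSeries χ B)‖ * (4 / (3 * q)) ^ n * (3 / 4 * q) ^ n := by
        rw [mul_assoc, ← mul_pow, h2, one_pow, mul_one]
    _ ≤ K * (3 / 4 * q) ^ n := by gcongr
    _ = _ := by rw [mul_pow, mul_assoc]

end EulerProduct

section Asymptotics

theorem exists_norm_sub_le_of_norm_succ_sub_le {u : ℕ → ℂ} {A r : ℝ} (hr : r < 1)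
    (h : ∀ n, ‖u (n + 1) - u n‖ ≤ A * r ^ n) :
    ∃ l : ℂ, ∀ n, ‖u n - l‖ ≤ A / (1 - r) * r ^ n := by
  have hd : ∀ n, dist (u n) (u (n + 1)) ≤ A * r ^ n := fun n => by
    rw [dist_comm, dist_eq_norm]
    exact h n
  obtain ⟨l, hl⟩ := cauchySeq_tendsto_of_complete (cauchySeq_of_le_geometric r A hr hd)
  refine ⟨l, fun n => ?_⟩
  rw [← dist_eq_norm]
  refine (dist_le_of_le_geometric_of_tendsto r A hr hd hl n).trans_eq ?_
  ring

theorem exists_norm_sub_linear_le {a b : ℕ → ℂ} {A r : ℝ} (hA : 0 ≤ A) (hr0 : 0 ≤ r) (hr : r < 1)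
    (hb : ∀ n, ‖b n‖ ≤ A * r ^ n) (h : ∀ n, a (n + 2) - 2 * a (n + 1) + a n = b n) :
    ∃ (c : ℂ) (K : ℝ), ∀ n, ‖a n - c * n‖ ≤ K := by
  obtain ⟨c, hc⟩ := exists_norm_sub_le_of_norm_succ_sub_le (u := fun n => a (n + 1) - a n) hr
    fun n => by
      have e : a (n + 1 + 1) - a (n + 1) - (a (n + 1) - a n) = b n := by rw [← h n]; ring
      simpa only [e] using hb n
  obtain ⟨l, hl⟩ := exists_norm_sub_le_of_norm_succ_sub_le (u := fun n => a n - c * n) hr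
    fun n => by
      have e : a (n + 1) - c * ((n + 1 : ℕ) : ℂ) - (a n - c * n) = a (n + 1) - a n - c := by
        push_cast; ring
      simpa only [e] using hc n
  have hA' : 0 ≤ A / (1 - r) / (1 - r) := by
    have : 0 < 1 - r := by linarith
    positivity
  refine ⟨c, A / (1 - r) / (1 - r) + ‖l‖, fun n => ?_⟩
  calc ‖a n - c * n‖ = ‖(a n - c * n - l) + l‖ := by rw [sub_add_cancel]
    _ ≤ A / (1 - r) / (1 - r) * r ^ n + ‖l‖ := (norm_add_le _ _).trans (by gcongr; exact hl n)
    _ ≤ A / (1 - r) / (1 - r) + ‖l‖ := by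
      gcongr
      exact mul_le_of_le_one_right hA' (pow_le_one₀ hr0 hr.le)

theorem exists_norm_le_of_period_three {a b : ℕ → ℂ} {A r : ℝ} (hA : 0 ≤ A) (hr0 : 0 ≤ r)
    (hr : r < 1) (hb : ∀ n, ‖b n‖ ≤ A * r ^ n) (h : ∀ n, a (n + 2) + a (n + 1) + a n = b n) :
    ∃ K : ℝ, ∀ n, ‖a n‖ ≤ K := by
  have hr1 : 0 < 1 - r := by linarith
  have hD : 0 ≤ 2 * A / (1 - r) := by positivity
  have hstep : ∀ n, ‖a (n + 3) - a n‖ ≤ 2 * A * r ^ n := fun n => by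
    have e : a (n + 3) - a n = b (n + 1) - b n := by
      rw [← h n, ← h (n + 1)]; ring
    have h2 : A * r ^ (n + 1) ≤ A * r ^ n := by
      gcongr ?_ * ?_
      exact pow_le_pow_of_le_one hr0 hr.le n.le_succ
    rw [e]
    linarith [norm_sub_le (b (n + 1)) (b n), hb n, hb (n + 1)]
  have key : ∀ n, ‖a n‖ ≤ ‖a 0‖ + ‖a 1‖ + ‖a 2‖ + 2 * A / (1 - r) * (1 - r ^ n) := by
    intro n
    induction n using Nat.strong_induction_on with
    | _ n ih =>
      have hpos : 0 ≤ 2 * A / (1 - r) * (1 - r ^ n) :=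
        mul_nonneg hD (by linarith [pow_le_one₀ (n := n) hr0 hr.le])
      match n, ih, hpos with
      | 0, _, hpos => linarith [norm_nonneg (a 1), norm_nonneg (a 2)]
      | 1, _, hpos => linarith [norm_nonneg (a 0), norm_nonneg (a 2)]
      | 2, _, hpos => linarith [norm_nonneg (a 0), norm_nonneg (a 1)]
      | n + 3, ih, _ =>
        have h1 := ih n (by omega)
        have h2 : ‖a (n + 3)‖ ≤ ‖a (n + 3) - a n‖ + ‖a n‖ := by
          simpa using norm_add_le (a (n + 3) - a n) (a n)
        have h3 : 2 * A * r ^ n = 2 * A / (1 - r) * (r ^ n - r ^ (n + 1)) := by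
          field_simp
          ring
        have h4 : r ^ (n + 3) ≤ r ^ (n + 1) := pow_le_pow_of_le_one hr0 hr.le (by omega)
        have h5 : 2 * A / (1 - r) * (r ^ n - r ^ (n + 1)) ≤
            2 * A / (1 - r) * (r ^ n - r ^ (n + 3)) := by gcongr
        linarith [hstep n]
  refine ⟨‖a 0‖ + ‖a 1‖ + ‖a 2‖ + 2 * A / (1 - r), fun n => (key n).trans ?_⟩
  gcongr
  exact mul_le_of_le_one_right hD (by linarith [pow_nonneg hr0 n])

variable {Fq : Type*} [Field Fq] [Fintype Fq] [DecidableEq Fq]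

theorem coeff_add_two_reducedSeries (χ : ℂ) (B : Fq[X]) (n : ℕ) :
    PowerSeries.coeff (n + 2) (reducedSeries χ B) = twistSum χ B (n + 2) -
      (χ + χ ^ 2) * Fintype.card Fq * twistSum χ B (n + 1) +
      χ ^ 3 * (Fintype.card Fq : ℂ) ^ 2 * twistSum χ B n := by
  have e : reducedSeries χ B = twistSeries χ B -
      twistSeries χ B * PowerSeries.C ((χ + χ ^ 2) * Fintype.card Fq) * PowerSeries.X +
      twistSeries χ B * PowerSeries.C (χ ^ 3 * (Fintype.card Fq : ℂ) ^ 2) * PowerSeries.X *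
        PowerSeries.X := by
    simp only [reducedSeries, map_mul, map_add, map_pow]
    ring
  rw [e, map_add, map_sub, PowerSeries.coeff_succ_mul_X, PowerSeries.coeff_succ_mul_X,
    PowerSeries.coeff_succ_mul_X, PowerSeries.coeff_mul_C, PowerSeries.coeff_mul_C]
  simp only [twistSeries, PowerSeries.coeff_mk]
  ring

theorem exists_norm_twistSum_sub_le {B : Fq[X]} (hB : B ≠ 0) {χ : ℂ} (hχ : χ ^ 3 = 1) :
    ∃ (c : ℂ) (K : ℝ), (χ = 1 ∨ c = 0) ∧ 0 ≤ K ∧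
      ∀ n : ℕ, ‖twistSum χ B n - c * n * (Fintype.card Fq : ℂ) ^ n‖ ≤
        K * (Fintype.card Fq : ℝ) ^ n := by
  obtain ⟨A, hA, hred⟩ := exists_norm_coeff_reducedSeries_le hB hχ
  have hq : (0 : ℝ) < Fintype.card Fq := by exact_mod_cast Fintype.card_pos
  have hqC : (Fintype.card Fq : ℂ) ≠ 0 := by exact_mod_cast hq.ne'
  have hrec := coeff_add_two_reducedSeries χ B
  set q : ℂ := (Fintype.card Fq : ℂ) with hqdef
  have hnq : ‖q‖ = (Fintype.card Fq : ℝ) := by simp [hqdef]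
  set a : ℕ → ℂ := fun n => twistSum χ B n / q ^ n with ha
  set b : ℕ → ℂ := fun n => PowerSeries.coeff (n + 2) (reducedSeries χ B) / q ^ (n + 2) with hb
  have hbn : ∀ n, ‖b n‖ ≤ A * (3 / 4) ^ n := fun n => by
    have h := hred (n + 2)
    rw [hb]
    simp only [norm_div, norm_pow, hnq]
    rw [div_le_iff₀ (by positivity)]
    refine h.trans ?_
    gcongr ?_ * ?_ * ?_
    exact pow_le_pow_of_le_one (by norm_num) (by norm_num) (by omega)
  have hab : ∀ n, a (n + 2) - (χ + χ ^ 2) * a (n + 1) + a n = b n := fun n => by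
    simp only [ha, hb, hrec, hχ, pow_add]
    field_simp
  have hmul : ∀ n, a n * q ^ n = twistSum χ B n := fun n => by
    simp only [ha]
    field_simp
  obtain ⟨c, K, hc, hK⟩ : ∃ (c : ℂ) (K : ℝ), (χ = 1 ∨ c = 0) ∧ ∀ n : ℕ, ‖a n - c * n‖ ≤ K := by
    by_cases h1 : χ = 1
    · obtain ⟨c, K, h⟩ := exists_norm_sub_linear_le (a := a) hA (by norm_num) (by norm_num) hbn
        fun n => by rw [← hab n, h1]; ring
      exact ⟨c, K, Or.inl h1, h⟩
    · have h2 : χ + χ ^ 2 = -1 := by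
        have : (χ - 1) * (χ + χ ^ 2 + 1) = 0 := by linear_combination hχ
        have := (mul_eq_zero.mp this).resolve_left (sub_ne_zero.mpr h1)
        linear_combination this
      obtain ⟨K, h⟩ := exists_norm_le_of_period_three (a := a) hA (by norm_num) (by norm_num) hbn
        fun n => by rw [← hab n, h2]; ring
      exact ⟨0, K, Or.inr rfl, fun n => by simpa using h n⟩
  refine ⟨c, K, hc, (norm_nonneg _).trans (hK 0), fun n => ?_⟩
  rw [← hmul n, ← sub_mul, norm_mul, norm_pow, hnq]
  gcongr
  exact hK n

end Asymptotics

section Comparison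

/-- The main factor `1 + ∑_{a=1}^{⌊N/m⌋} (-2/q^m)^a (1 - am/N)`. -/
noncomputable def mainFactor (q : ℝ) (m N : ℕ) : ℝ :=
  1 + ∑ a ∈ Finset.Icc 1 (N / m), (-2 / q ^ m) ^ a * (1 - (a : ℝ) * m / N)

theorem mainFactor_eq_sum_range (q : ℝ) (m N : ℕ) :
    mainFactor q m N =
      ∑ a ∈ Finset.range (N / m + 1), (-2 / q ^ m) ^ a * (1 - (a : ℝ) * m / N) := by
  rw [mainFactor, Finset.range_eq_Ico, Finset.sum_eq_sum_Ico_succ_bot (Nat.succ_pos _)]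
  simp [Finset.Ico_add_one_right_eq_Icc]

theorem sum_neg_one_pow_mul_sub (x : ℝ) (L : ℕ) :
    ∑ a ∈ Finset.range (L + 1), (-1 : ℝ) ^ a * (x - a) =
      x / 2 + 1 / 4 + (-1) ^ L * (x / 2 - L / 2 - 1 / 4) := by
  induction L with
  | zero => simp
  | succ L ih =>
    rw [Finset.sum_range_succ, ih, pow_succ]
    push_cast
    ring

theorem mainFactor_two_one {N : ℕ} (hN : 1 ≤ N) :
    mainFactor 2 1 N = 1 / 2 + (1 - (-1) ^ N) / (4 * N) := by
  have hN0 : (N : ℝ) ≠ 0 := by positivity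
  have h : ∑ a ∈ Finset.range (N + 1), (-1 : ℝ) ^ a * (1 - (a : ℝ) * (1 : ℕ) / N) =
      (∑ a ∈ Finset.range (N + 1), (-1 : ℝ) ^ a * (N - a)) / N := by
    rw [Finset.sum_div]
    refine Finset.sum_congr rfl fun a _ => ?_
    field_simp
    simp
  rw [mainFactor_eq_sum_range, Nat.div_one, show (-2 / 2 ^ 1 : ℝ) = -1 by norm_num, h,
    sum_neg_one_pow_mul_sub]
  field_simp
  ring

variable {Fq : Type*} [Field Fq] [Fintype Fq] [DecidableEq Fq]

theorem twistSum_mul_eq_sum (χ : ℂ) {P B : Fq[X]} (hP : P.Monic) (hPi : Irreducible P)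
    (hPB : ¬P ∣ B) (N : ℕ) :
    twistSum χ (P * B) N = ∑ a ∈ Finset.range (N / P.natDegree + 1),
      (-(χ ^ P.natDegree + χ ^ (2 * P.natDegree))) ^ a * twistSum χ B (N - a * P.natDegree) := by
  have hm := hPi.natDegree_pos
  induction N using Nat.strong_induction_on with
  | _ N ih =>
    rcases lt_or_ge N P.natDegree with h | h
    · rw [twistSum_mul_of_lt χ hP hPi h, Nat.div_eq_of_lt h]
      simp
    · obtain ⟨n, rfl⟩ := Nat.exists_eq_add_of_le h
      rw [← sub_eq_of_eq_add (twistSum_add_natDegree χ hP hPi hPB n), ih n (by omega),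
        Nat.add_div_left n hm, Finset.sum_range_succ' _ (n / P.natDegree + 1), Finset.mul_sum,
        sub_eq_add_neg, ← Finset.sum_neg_distrib, add_comm]
      congr 1
      · refine Finset.sum_congr rfl fun a _ => ?_
        rw [show P.natDegree + n - (a + 1) * P.natDegree = n - a * P.natDegree by
          rw [add_mul, one_mul]; omega]
        ring
      · simp

theorem norm_twist_factor_le {χ : ℂ} (hχ : χ ^ 3 = 1) (m : ℕ) :
    ‖χ ^ m + χ ^ (2 * m)‖ ≤ 2 := by
  refine (norm_add_le _ _).trans ?_
  rw [norm_pow, norm_pow, Complex.norm_eq_one_of_pow_eq_one hχ (by norm_num)]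
  norm_num

theorem sum_Icc_pow_le {x : ℝ} (hx : 0 ≤ x) (hx1 : x ≤ 2 / 3) (L : ℕ) :
    ∑ a ∈ Finset.Icc 1 L, x ^ a ≤ 3 * x := by
  suffices h : ∑ a ∈ Finset.Icc 1 L, x ^ a ≤ 3 * x - 3 * x * x ^ L by
    have : 0 ≤ 3 * x * x ^ L := by positivity
    linarith
  induction L with
  | zero => simp
  | succ L ih =>
    rw [Finset.sum_Icc_succ_top (by omega)]
    have : 0 ≤ x ^ (L + 1) * (2 / 3 - x) := mul_nonneg (by positivity) (by linarith)
    rw [pow_succ] at this ⊢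
    nlinarith

theorem norm_twistSum_mul_sub_le_of_three_le {χ : ℂ} (hχ : χ ^ 3 = 1) {P B : Fq[X]} (hP : P.Monic)
    (hPi : Irreducible P) (hPB : ¬P ∣ B) {c : ℂ} {K : ℝ} (hc : χ = 1 ∨ c = 0) (hK : 0 ≤ K)
    (h : ∀ n : ℕ, ‖twistSum χ B n - c * n * (Fintype.card Fq : ℂ) ^ n‖ ≤
      K * (Fintype.card Fq : ℝ) ^ n)
    (h3 : 3 ≤ Fintype.card Fq ^ P.natDegree) {N : ℕ} (hN : 1 ≤ N) :
    ‖twistSum χ (P * B) N - twistSum χ B N * mainFactor (Fintype.card Fq) P.natDegree N‖ ≤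
      12 * K * (Fintype.card Fq : ℝ) ^ N / (Fintype.card Fq : ℝ) ^ P.natDegree := by
  have hq : (0 : ℝ) < Fintype.card Fq := by exact_mod_cast Fintype.card_pos
  have hqC : (Fintype.card Fq : ℂ) ≠ 0 := by exact_mod_cast hq.ne'
  have hN0 : (N : ℂ) ≠ 0 := by exact_mod_cast (by omega : N ≠ 0)
  have h3' : (3 : ℝ) ≤ (Fintype.card Fq : ℝ) ^ P.natDegree := by exact_mod_cast h3
  have hε := norm_twist_factor_le hχ P.natDegree
  have hεc : χ ^ P.natDegree + χ ^ (2 * P.natDegree) = 2 ∨ c = 0 :=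
    hc.imp_left fun h1 => by rw [h1]; norm_num
  have hnq : ‖(Fintype.card Fq : ℂ)‖ = Fintype.card Fq := by simp
  rw [twistSum_mul_eq_sum χ hP hPi hPB, mainFactor_eq_sum_range]
  set ε := χ ^ P.natDegree + χ ^ (2 * P.natDegree)
  set m := P.natDegree
  have hcast : ((Fintype.card Fq : ℝ) : ℂ) = (Fintype.card Fq : ℂ) := by simp
  push_cast
  set q : ℂ := (Fintype.card Fq : ℂ)
  set r : ℝ := (Fintype.card Fq : ℝ)
  set e : ℕ → ℂ := fun n => twistSum χ B n - c * n * q ^ n with he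
  have hS : ∀ n, twistSum χ B n = c * n * q ^ n + e n := fun n => by simp only [he]; ring
  rw [Finset.mul_sum, ← Finset.sum_sub_distrib, Finset.range_eq_Ico,
    Finset.sum_eq_sum_Ico_succ_bot (Nat.succ_pos _)]
  simp only [pow_zero, zero_mul, Nat.sub_zero, one_mul, Nat.cast_zero, zero_div, sub_zero, mul_one,
    sub_self, zero_add]
  have hterm : ∀ a ∈ Finset.Icc 1 (N / m), ‖(-ε) ^ a * twistSum χ B (N - a * m) -
      twistSum χ B N * ((-2 / q ^ m) ^ a * (1 - (a : ℂ) * m / N))‖ ≤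
        2 * K * r ^ N * (2 / r ^ m) ^ a := by
    intro a ha
    have ham : a * m ≤ N :=
      (Nat.mul_le_mul_right m (Finset.mem_Icc.mp ha).2).trans (Nat.div_mul_le_self N m)
    have hfrac : ‖(1 - (a : ℂ) * m / N)‖ ≤ 1 := by
      have e1 : (1 - (a : ℂ) * m / N) = (((N - a * m : ℕ) : ℝ) / N : ℝ) := by
        push_cast [Nat.cast_sub ham]
        field_simp
      rw [e1, Complex.norm_real, Real.norm_of_nonneg (by positivity)]
      exact div_le_one_of_le₀ (by exact_mod_cast Nat.sub_le _ _) (by positivity)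
    have hqpow : q ^ N = q ^ (N - a * m) * (q ^ m) ^ a := by
      rw [← pow_mul, ← pow_add, mul_comm m a, Nat.sub_add_cancel ham]
    have hrpow : r ^ N = r ^ (N - a * m) * (r ^ m) ^ a := by
      rw [← pow_mul, ← pow_add, mul_comm m a, Nat.sub_add_cancel ham]
    have hmain : (-ε) ^ a * (c * ((N - a * m : ℕ) : ℂ) * q ^ (N - a * m)) -
        c * N * q ^ N * ((-2 / q ^ m) ^ a * (1 - (a : ℂ) * m / N)) = 0 := by
      rcases hεc with h1 | h1
      · rw [h1, hqpow, div_pow]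
        push_cast [Nat.cast_sub ham]
        field_simp
        ring
      · simp [h1]
    have hsplit : (-ε) ^ a * twistSum χ B (N - a * m) -
        twistSum χ B N * ((-2 / q ^ m) ^ a * (1 - (a : ℂ) * m / N)) =
        (-ε) ^ a * e (N - a * m) - e N * ((-2 / q ^ m) ^ a * (1 - (a : ℂ) * m / N)) := by
      rw [hS, hS N]
      linear_combination hmain
    rw [hsplit]
    have b1 : ‖(-ε) ^ a * e (N - a * m)‖ ≤ K * r ^ N * (2 / r ^ m) ^ a := by
      rw [norm_mul, norm_pow, norm_neg]
      calc ‖ε‖ ^ a * ‖e (N - a * m)‖ ≤ 2 ^ a * (K * r ^ (N - a * m)) := by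
            gcongr
            exact h _
        _ = _ := by
            rw [hrpow, div_pow]
            field_simp
    have b2 : ‖e N * ((-2 / q ^ m) ^ a * (1 - (a : ℂ) * m / N))‖ ≤
        K * r ^ N * (2 / r ^ m) ^ a := by
      rw [norm_mul, norm_mul, norm_pow, norm_div, norm_neg, norm_pow, hnq, Complex.norm_two]
      calc ‖e N‖ * ((2 / r ^ m) ^ a * ‖(1 - (a : ℂ) * m / N)‖)
          ≤ (K * r ^ N) * ((2 / r ^ m) ^ a * 1) := by
            gcongr
            exact h _
        _ = _ := by ring
    linarith [norm_sub_le ((-ε) ^ a * e (N - a * m))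
      (e N * ((-2 / q ^ m) ^ a * (1 - (a : ℂ) * m / N)))]
  refine (norm_sum_le _ _).trans ((Finset.sum_le_sum hterm).trans ?_)
  rw [← Finset.mul_sum]
  calc 2 * K * r ^ N * ∑ a ∈ Finset.Icc 1 (N / m), (2 / r ^ m) ^ a
      ≤ 2 * K * r ^ N * (3 * (2 / r ^ m)) := by
        gcongr
        refine sum_Icc_pow_le (by positivity) ?_ _
        rw [div_le_div_iff₀ (by positivity) (by norm_num)]
        linarith
    _ = _ := by ring

theorem norm_twistSum_mul_sub_le_of_card_eq_two {χ : ℂ} (hχ : χ ^ 3 = 1) {P B : Fq[X]}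
    (hP : P.Monic) (hPi : Irreducible P) (hPB : ¬P ∣ B) {c : ℂ} {K : ℝ} (hc : χ = 1 ∨ c = 0)
    (hK : 0 ≤ K)
    (h : ∀ n : ℕ, ‖twistSum χ (P * B) n - c * n * (Fintype.card Fq : ℂ) ^ n‖ ≤
      K * (Fintype.card Fq : ℝ) ^ n)
    (hq : Fintype.card Fq = 2) (hm : P.natDegree = 1) {N : ℕ} (hN : 1 ≤ N) :
    ‖twistSum χ (P * B) N - twistSum χ B N * mainFactor (Fintype.card Fq) P.natDegree N‖ ≤
      (4 * ‖c‖ + 6 * K) * (Fintype.card Fq : ℝ) ^ N / (Fintype.card Fq : ℝ) ^ P.natDegree := by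
  obtain ⟨n, rfl⟩ := Nat.exists_eq_add_of_le hN
  have hrec := twistSum_add_natDegree χ hP hPi hPB n
  have hε := norm_twist_factor_le hχ P.natDegree
  have hεc : χ ^ P.natDegree + χ ^ (2 * P.natDegree) = 2 ∨ c = 0 :=
    hc.imp_left fun h1 => by rw [h1]; norm_num
  simp only [hq, Nat.cast_ofNat] at h ⊢
  set ε := χ ^ P.natDegree + χ ^ (2 * P.natDegree)
  rw [hm] at hrec ⊢
  set s := mainFactor 2 1 (1 + n) with hs
  have hn : (0 : ℝ) < ((1 + n : ℕ) : ℝ) := by positivity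
  have hn1 : (1 : ℝ) ≤ ((1 + n : ℕ) : ℝ) := by exact_mod_cast hN
  have hsv : s = 1 / 2 + (1 - (-1) ^ (1 + n)) / (4 * ((1 + n : ℕ) : ℝ)) := mainFactor_two_one hN
  have hδ : |1 - 2 * s| ≤ 1 / ((1 + n : ℕ) : ℝ) ∧ |s| ≤ 1 := by
    rcases neg_one_pow_eq_or ℝ (1 + n) with h1 | h1
    · rw [hsv, h1]
      norm_num
      positivity
    · have h2 : s = 1 / 2 + 1 / ((1 + n : ℕ) : ℝ) / 2 := by
        rw [hsv, h1]
        field_simp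
        ring
      have h3 : 1 / ((1 + n : ℕ) : ℝ) ≤ 1 := (div_le_one hn).mpr hn1
      have h4 : 0 < 1 / ((1 + n : ℕ) : ℝ) := by positivity
      rw [h2]
      constructor <;> rw [abs_le] <;> constructor <;> linarith
  set y := twistSum χ (P * B)
  have e1 : y (1 + n) - twistSum χ B (1 + n) * (s : ℂ) =
      y (1 + n) * ((1 - 2 * s : ℝ) : ℂ) + (s : ℂ) * (y (1 + n) - ε * y n) := by
    rw [hrec]
    push_cast
    ring
  have hy : ‖y (1 + n)‖ ≤ (‖c‖ * ((1 + n : ℕ) : ℝ) + K) * 2 ^ (1 + n) := by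
    have h1 := norm_add_le (y (1 + n) - c * ((1 + n : ℕ) : ℂ) * 2 ^ (1 + n))
      (c * ((1 + n : ℕ) : ℂ) * 2 ^ (1 + n))
    rw [sub_add_cancel, norm_mul, norm_mul, norm_pow, Complex.norm_two, Complex.norm_natCast] at h1
    linarith [h (1 + n)]
  have hd : ‖y (1 + n) - ε * y n‖ ≤ (‖c‖ + 2 * K) * 2 ^ (1 + n) := by
    have e2 : y (1 + n) - ε * y n = (y (1 + n) - c * ((1 + n : ℕ) : ℂ) * 2 ^ (1 + n)) -
        ε * (y n - c * n * 2 ^ n) + c * 2 ^ (1 + n) := by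
      rcases hεc with h1 | h1
      · rw [h1]
        push_cast
        ring
      · simp [h1]
    have h1 : ‖ε * (y n - c * n * 2 ^ n)‖ ≤ 2 * (K * 2 ^ n) := by
      rw [norm_mul]
      gcongr
      exact h n
    have h2 : ‖c * 2 ^ (1 + n)‖ = ‖c‖ * 2 ^ (1 + n) := by
      rw [norm_mul, norm_pow, Complex.norm_two]
    have h3 : K * (2 : ℝ) ^ (1 + n) = 2 * (K * 2 ^ n) := by ring
    have h5 := h (1 + n)
    rw [e2]
    refine (norm_add_le _ _).trans ?_
    rw [h2]
    have h4 := norm_sub_le (y (1 + n) - c * ((1 + n : ℕ) : ℂ) * 2 ^ (1 + n))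
      (ε * (y n - c * n * 2 ^ n))
    linarith
  have f1 : ‖y (1 + n) * ((1 - 2 * s : ℝ) : ℂ)‖ ≤ (‖c‖ + K) * 2 ^ (1 + n) := by
    rw [norm_mul, Complex.norm_real, Real.norm_eq_abs]
    calc ‖y (1 + n)‖ * |1 - 2 * s|
        ≤ (‖c‖ * ((1 + n : ℕ) : ℝ) + K) * 2 ^ (1 + n) * (1 / ((1 + n : ℕ) : ℝ)) := by
          gcongr
          exact hδ.1
      _ = (‖c‖ + K / ((1 + n : ℕ) : ℝ)) * 2 ^ (1 + n) := by field_simp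
      _ ≤ _ := by
          gcongr
          exact div_le_self hK hn1
  have f2 : ‖(s : ℂ) * (y (1 + n) - ε * y n)‖ ≤ (‖c‖ + 2 * K) * 2 ^ (1 + n) := by
    rw [norm_mul, Complex.norm_real, Real.norm_eq_abs]
    exact (mul_le_of_le_one_left (norm_nonneg _) hδ.2).trans hd
  rw [e1, pow_one]
  refine (norm_add_le _ _).trans ?_
  linarith

theorem exists_norm_twistSum_mul_sub_le {B : Fq[X]} (hB : B ≠ 0) {χ : ℂ} (hχ : χ ^ 3 = 1) :
    ∃ C : ℝ, ∀ N : ℕ, 1 ≤ N → ∀ P : Fq[X], P.Monic → Irreducible P → ¬P ∣ B →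
      ‖twistSum χ (P * B) N - twistSum χ B N * mainFactor (Fintype.card Fq) P.natDegree N‖ ≤
        C * (Fintype.card Fq : ℝ) ^ N / (Fintype.card Fq : ℝ) ^ P.natDegree := by
  have hq1 := Fintype.one_lt_card (α := Fq)
  obtain ⟨c, K, hc, hK, h⟩ := exists_norm_twistSum_sub_le hB hχ
  have hsmall : ∀ P : Fq[X], ∃ C : ℝ, P.Monic → Irreducible P → ¬P ∣ B →
      Fintype.card Fq = 2 → P.natDegree = 1 → ∀ N : ℕ, 1 ≤ N →
      ‖twistSum χ (P * B) N - twistSum χ B N * mainFactor (Fintype.card Fq) P.natDegree N‖ ≤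
        C * (Fintype.card Fq : ℝ) ^ N / (Fintype.card Fq : ℝ) ^ P.natDegree := fun P => by
    by_cases hP0 : P = 0
    · exact ⟨0, fun hP => absurd hP0 hP.ne_zero⟩
    · obtain ⟨c', K', hc', hK', h'⟩ := exists_norm_twistSum_sub_le (mul_ne_zero hP0 hB) hχ
      exact ⟨4 * ‖c'‖ + 6 * K', fun hP hPi hPB hq hm N hN =>
        norm_twistSum_mul_sub_le_of_card_eq_two hχ hP hPi hPB hc' hK' h' hq hm hN⟩
  choose f hf using hsmall
  obtain ⟨M, hM⟩ := ((finite_setOf_natDegree_le (Fq := Fq) 1).image f).bddAbove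
  refine ⟨max (12 * K) M, fun N hN P hP hPi hPB => ?_⟩
  have hm := hPi.natDegree_pos
  by_cases h3 : 3 ≤ Fintype.card Fq ^ P.natDegree
  · refine (norm_twistSum_mul_sub_le_of_three_le hχ hP hPi hPB hc hK h h3 hN).trans ?_
    gcongr
    exact le_max_left _ _
  · have hm1 : P.natDegree = 1 := by
      by_contra hne
      have h4 : Fintype.card Fq ^ 2 ≤ Fintype.card Fq ^ P.natDegree :=
        Nat.pow_le_pow_right (by omega) (by omega)
      nlinarith
    have hq : Fintype.card Fq = 2 := by
      rw [hm1, pow_one] at h3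
      omega
    refine (hf P hP hPi hPB hq hm1 N hN).trans ?_
    gcongr
    exact (hM (Set.mem_image_of_mem f hm1.le)).trans (le_max_right _ _)

end Comparison

section Sieve

variable {Fq : Type*} [Field Fq] [Fintype Fq] [DecidableEq Fq]

theorem sum_pow_of_isPrimitiveRoot_three {ω : ℂ} (hω : IsPrimitiveRoot ω 3) (d : ℕ) :
    1 + ω ^ d + (ω ^ 2) ^ d = if 3 ∣ d then 3 else 0 := by
  split_ifs with h
  · obtain ⟨k, rfl⟩ := h
    rw [← pow_mul, show 2 * (3 * k) = 3 * (2 * k) by ring, pow_mul, pow_mul, hω.pow_eq_one]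
    norm_num
  · have h1 : ω ^ d ≠ 1 := fun h1 => h (hω.dvd_of_pow_eq_one d h1)
    have h3 : (ω ^ d) ^ 3 = 1 := by rw [← pow_mul, mul_comm, pow_mul, hω.pow_eq_one, one_pow]
    rw [← pow_mul, mul_comm 2 d, pow_mul]
    have : (ω ^ d - 1) * (1 + ω ^ d + (ω ^ d) ^ 2) = 0 := by linear_combination h3
    exact (mul_eq_zero.mp this).resolve_left (sub_ne_zero.mpr h1)

theorem three_mul_ncard_cubicTwistFamily {ω : ℂ} (hω : IsPrimitiveRoot ω 3) (B : Fq[X]) (N : ℕ) :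
    3 * ((cubicTwistFamily B N).ncard : ℂ) =
      twistSum 1 B N + twistSum ω B N + twistSum (ω ^ 2) B N := by
  have hfin := finite_cubeFreeFamily B N
  have hset : cubicTwistFamily B N =
      ((hfin.toFinset.filter fun D => 3 ∣ D.natDegree : Finset Fq[X]) : Set Fq[X]) := by
    ext D
    simp only [Finset.coe_filter, Set.Finite.mem_toFinset, cubicTwistFamily, cubeFreeFamily,
      Set.mem_ofPred_eq]
    tauto
  have hsum : ∀ χ : ℂ, twistSum χ B N = ∑ D ∈ hfin.toFinset, χ ^ D.natDegree := fun χ =>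
    finsum_mem_eq_finite_toFinset_sum _ hfin
  rw [hset, Set.ncard_coe_finset, hsum, hsum, hsum, ← Finset.sum_add_distrib,
    ← Finset.sum_add_distrib]
  simp only [one_pow, sum_pow_of_isPrimitiveRoot_three hω]
  rw [← Finset.sum_filter, Finset.sum_const, nsmul_eq_mul, mul_comm]

end Sieve

/-- Proposition 4.4 of the paper: for a monic irreducible `P ∤ B` of degree `m`,
`#F_N(PB) = #F_N(B)·(1 + ∑_{a=1}^{⌊N/m⌋} (-2/q^m)^a (1 - am/N)) + O(q^{N-m})`. -/
theorem cubic_family_coprime_proportion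
    (Fq : Type*) [Field Fq] [Fintype Fq] [DecidableEq Fq]
    (B : Fq[X]) (hB : B ≠ 0) :
    ∃ C : ℝ, ∀ N : ℕ, 1 ≤ N → ∀ P : Fq[X], P.Monic → Irreducible P → ¬P ∣ B →
      |((cubicTwistFamily (P * B) N).ncard : ℝ) -
          ((cubicTwistFamily B N).ncard : ℝ) *
            (1 + ∑ a ∈ Finset.Icc 1 (N / P.natDegree),
              (-2 / (Fintype.card Fq : ℝ) ^ P.natDegree) ^ a *
                (1 - (a : ℝ) * P.natDegree / N))| ≤
        C * (Fintype.card Fq : ℝ) ^ N / (Fintype.card Fq : ℝ) ^ P.natDegree := by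
  have hω := Complex.isPrimitiveRoot_exp 3 (by norm_num)
  set ω := Complex.exp (2 * Real.pi * Complex.I / (3 : ℕ))
  have hω2 : (ω ^ 2) ^ 3 = 1 := by rw [← pow_mul, mul_comm, pow_mul, hω.pow_eq_one, one_pow]
  obtain ⟨C₀, h₀⟩ := exists_norm_twistSum_mul_sub_le hB (one_pow (M := ℂ) 3)
  obtain ⟨C₁, h₁⟩ := exists_norm_twistSum_mul_sub_le hB hω.pow_eq_one
  obtain ⟨C₂, h₂⟩ := exists_norm_twistSum_mul_sub_le hB hω2
  refine ⟨(C₀ + C₁ + C₂) / 3, fun N hN P hP hPi hPB => ?_⟩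
  have b₀ := h₀ N hN P hP hPi hPB
  have b₁ := h₁ N hN P hP hPi hPB
  have b₂ := h₂ N hN P hP hPi hPB
  have e₁ := three_mul_ncard_cubicTwistFamily hω (P * B) N
  have e₂ := three_mul_ncard_cubicTwistFamily hω B N
  change |_ - _ * mainFactor (Fintype.card Fq) P.natDegree N| ≤ _
  set s := mainFactor (Fintype.card Fq) P.natDegree N
  have hsplit : (((cubicTwistFamily (P * B) N).ncard - (cubicTwistFamily B N).ncard * s : ℝ) : ℂ) *
      3 = (twistSum 1 (P * B) N - twistSum 1 B N * s) +
        (twistSum ω (P * B) N - twistSum ω B N * s) +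
        (twistSum (ω ^ 2) (P * B) N - twistSum (ω ^ 2) B N * s) := by
    push_cast
    linear_combination e₁ - s * e₂
  have hnorm := (congrArg norm hsplit).le.trans norm_add₃_le
  rw [norm_mul, Complex.norm_real, Real.norm_eq_abs, Complex.norm_ofNat] at hnorm
  calc _ ≤ (C₀ * (Fintype.card Fq : ℝ) ^ N / (Fintype.card Fq : ℝ) ^ P.natDegree +
        C₁ * (Fintype.card Fq : ℝ) ^ N / (Fintype.card Fq : ℝ) ^ P.natDegree +
        C₂ * (Fintype.card Fq : ℝ) ^ N / (Fintype.card Fq : ℝ) ^ P.natDegree) / 3 := by linarith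
    _ = _ := by ring
end

section
/- Let 𝔽_q be a finite field and let B ∈ 𝔽_q[T] be nonzero. There exist real numbers a > 0 and b such that for every ε > 0 there is a constant C_ε with | N_d(B) − (a·d + b)·q^d | ≤ C_ε · q^{(1/2 + ε)d} for all d ≥ 0. -/
open Polynomial UniqueFactorizationMonoid

/-- `N_d(B)`: the number of monic cube-free polynomials coprime to `B` with
`deg(rad D) = d`. -/
noncomputable def cubeFreeCount {Fq : Type*} [Field Fq] [DecidableEq Fq]
    (B : Fq[X]) (d : ℕ) : ℕ :=
  {D : Fq[X] | D.Monic ∧ D.CubeFree ∧ IsCoprime D B ∧ D.radDeg = d}.ncard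

section Counting

variable {Fq : Type*} [Field Fq]

theorem Polynomial.finite_monic_natDegree_eq [Finite Fq] (m : ℕ) :
    {P : Fq[X] | P.Monic ∧ P.natDegree = m}.Finite := by
  have e := (monicEquivDegreeLT (R := Fq) m).trans (degreeLTEquiv Fq m).toEquiv
  exact Set.finite_coe_iff.mp (Finite.of_equiv _ e.symm)

theorem Polynomial.ncard_monic_natDegree_eq [Fintype Fq] (m : ℕ) :
    {P : Fq[X] | P.Monic ∧ P.natDegree = m}.ncard = Fintype.card Fq ^ m := by
  have e := (monicEquivDegreeLT (R := Fq) m).trans (degreeLTEquiv Fq m).toEquiv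
  rw [← Nat.card_coe_set_eq]
  refine (Nat.card_congr e).trans ?_
  simp

theorem Polynomial.finite_monic_natDegree_le [Finite Fq] (n : ℕ) :
    {P : Fq[X] | P.Monic ∧ P.natDegree ≤ n}.Finite := by
  refine ((Set.finite_Iic n).biUnion fun m _ => finite_monic_natDegree_eq (Fq := Fq) m).subset ?_
  intro P hP
  simpa using hP

/-- The finite set of monic irreducible polynomials of degree at most `n`. -/
noncomputable def Polynomial.monicIrreducibles (Fq : Type*) [Field Fq] [Finite Fq] (n : ℕ) :
    Finset Fq[X] :=
  ((finite_monic_natDegree_le (Fq := Fq) n).subset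
    (Set.inter_subset_left (t := {P | Irreducible P}))).toFinset

theorem Polynomial.mem_monicIrreducibles [Finite Fq] {n : ℕ} {P : Fq[X]} :
    P ∈ monicIrreducibles Fq n ↔ (P.Monic ∧ P.natDegree ≤ n) ∧ Irreducible P := by
  simp [monicIrreducibles]

theorem Polynomial.normalizedFactors_prod_pow [DecidableEq Fq] {ι : Type*} (s : Finset ι)
    (f : ι → Fq[X]) (hm : ∀ i ∈ s, (f i).Monic) (hi : ∀ i ∈ s, Irreducible (f i)) (p : ι → ℕ) :
    normalizedFactors (∏ i ∈ s, f i ^ p i) = ∑ i ∈ s, p i • {f i} := by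
  classical
  induction s using Finset.induction_on with
  | empty => simp
  | insert a s ha ih =>
    rw [Finset.prod_insert ha, Finset.sum_insert ha, normalizedFactors_mul,
      ih (fun i h => hm i (Finset.mem_insert_of_mem h))
        (fun i h => hi i (Finset.mem_insert_of_mem h)),
      normalizedFactors_pow, normalizedFactors_irreducible (hi a (Finset.mem_insert_self a s)),
      (hm a (Finset.mem_insert_self a s)).normalize_eq_self]
    · exact pow_ne_zero _ (hi a (Finset.mem_insert_self a s)).ne_zero
    · exact Finset.prod_ne_zero_iff.mpr fun i h =>
        pow_ne_zero _ (hi i (Finset.mem_insert_of_mem h)).ne_zero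

theorem Polynomial.count_normalizedFactors_prod_pow [DecidableEq Fq] (S : Finset Fq[X])
    (hm : ∀ Q ∈ S, Q.Monic) (hi : ∀ Q ∈ S, Irreducible Q) (p : S → ℕ) (Q : S) :
    (normalizedFactors (∏ P : S, (P : Fq[X]) ^ p P)).count (Q : Fq[X]) = p Q := by
  rw [normalizedFactors_prod_pow _ _ (fun i _ => hm _ i.2) (fun i _ => hi _ i.2),
    Multiset.count_sum']
  simp [Multiset.count_singleton]

theorem Polynomial.Monic.prod_pow_count_normalizedFactors [DecidableEq Fq] {D : Fq[X]}
    (hD : D.Monic) {S : Finset Fq[X]} (hS : ∀ Q ∈ normalizedFactors D, Q ∈ S) :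
    ∏ Q ∈ S, Q ^ (normalizedFactors D).count Q = D := by
  rw [← Finset.prod_multiset_count_of_subset _ _ fun Q hQ => hS Q (Multiset.mem_toFinset.mp hQ),
    prod_normalizedFactors_eq, hD.normalize_eq_self]
  exact hD.ne_zero

/-- A truncated Euler product is the generating function of the monic polynomials with prescribed
factors and multiplicities. -/
theorem Polynomial.coeff_prod_sum_X_pow [DecidableEq Fq] (S : Finset Fq[X])
    (hm : ∀ Q ∈ S, Q.Monic) (hi : ∀ Q ∈ S, Irreducible Q) (t : Fq[X] → Finset ℕ) (e : ℕ → ℕ)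
    (k : ℕ) :
    (∏ Q ∈ S, ∑ j ∈ t Q, (X : ℝ[X]) ^ (e j * Q.natDegree)).coeff k =
      {D : Fq[X] | D.Monic ∧ (∀ Q ∈ normalizedFactors D, Q ∈ S) ∧
        (∀ Q ∈ S, (normalizedFactors D).count Q ∈ t Q) ∧
        ∑ Q ∈ S, e ((normalizedFactors D).count Q) * Q.natDegree = k}.ncard := by
  classical
  rw [← Finset.prod_coe_sort, Finset.prod_univ_sum, finsetSum_coeff]
  simp_rw [Finset.prod_pow_eq_pow_sum, coeff_X_pow]
  rw [Finset.sum_boole, ← Set.ncard_coe_finset]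
  congr 1
  have hc := count_normalizedFactors_prod_pow S hm hi
  rw [← Set.InjOn.ncard_image (f := fun p : S → ℕ => ∏ P : S, (P : Fq[X]) ^ p P)]
  · congr 1
    ext D
    simp only [Set.mem_image, Finset.coe_filter, Fintype.mem_piFinset, Set.mem_ofPred_eq]
    constructor
    · rintro ⟨p, ⟨hp, rfl⟩, rfl⟩
      refine ⟨monic_prod_of_monic _ _ fun Q _ => (hm _ Q.2).pow _, ?_, ?_, ?_⟩
      · intro Q hQ
        rw [normalizedFactors_prod_pow _ _ (fun i _ => hm _ i.2) (fun i _ => hi _ i.2),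
          Multiset.mem_sum] at hQ
        obtain ⟨P, -, hP⟩ := hQ
        rw [Multiset.mem_singleton.mp (Multiset.mem_of_mem_nsmul hP)]
        exact P.2
      · intro Q hQ
        rw [hc p ⟨Q, hQ⟩]
        exact hp ⟨Q, hQ⟩
      · rw [← Finset.sum_coe_sort]
        simp_rw [hc]
    · rintro ⟨hD, hDS, hDt, rfl⟩
      refine ⟨fun Q => (normalizedFactors D).count (Q : Fq[X]), ⟨fun Q => hDt Q Q.2, ?_⟩, ?_⟩
      · exact (Finset.sum_coe_sort S
          fun Q => e ((normalizedFactors D).count Q) * Q.natDegree).symm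
      · exact (Finset.prod_coe_sort S fun Q => Q ^ (normalizedFactors D).count Q).trans
          (hD.prod_pow_count_normalizedFactors hDS)
  · intro p _ p' _ h
    funext Q
    rw [← hc p Q, ← hc p' Q]
    exact congrArg (fun D => (normalizedFactors D).count (Q : Fq[X])) h

theorem Polynomial.mem_monicIrreducibles_of_mem_normalizedFactors [Finite Fq] [DecidableEq Fq]
    {D Q : Fq[X]} {n : ℕ} (hD : D ≠ 0) (hQ : Q ∈ normalizedFactors D) (hn : Q.natDegree ≤ n) :
    Q ∈ monicIrreducibles Fq n := by
  rw [Polynomial.mem_normalizedFactors_iff hD] at hQ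
  exact mem_monicIrreducibles.mpr ⟨⟨hQ.2.1, hn⟩, hQ.1⟩

theorem Polynomial.Monic.natDegree_eq_sum_count [DecidableEq Fq] {D : Fq[X]}
    (hD : D.Monic) {S : Finset Fq[X]} (hS : ∀ Q ∈ normalizedFactors D, Q ∈ S)
    (hm : ∀ Q ∈ S, Q.Monic) :
    D.natDegree = ∑ Q ∈ S, (normalizedFactors D).count Q * Q.natDegree := by
  conv_lhs => rw [← hD.prod_pow_count_normalizedFactors hS]
  rw [natDegree_prod_of_monic _ _ fun Q hQ => (hm Q hQ).pow _]
  simp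

theorem Polynomial.coeff_prod_geom_monicIrreducibles [Fintype Fq] {n k : ℕ} (hk : k ≤ n) :
    (∏ Q ∈ monicIrreducibles Fq n,
      ∑ j ∈ Finset.range (n + 1), (X : ℝ[X]) ^ (j * Q.natDegree)).coeff k =
      (Fintype.card Fq : ℝ) ^ k := by
  classical
  have hm : ∀ Q ∈ monicIrreducibles Fq n, Q.Monic := fun Q h => (mem_monicIrreducibles.mp h).1.1
  have hi : ∀ Q ∈ monicIrreducibles Fq n, Irreducible Q := fun Q h => (mem_monicIrreducibles.mp h).2
  rw [coeff_prod_sum_X_pow _ hm hi (fun _ => Finset.range (n + 1)) (fun j => j), ← Nat.cast_pow,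
    ← ncard_monic_natDegree_eq]
  congr 2
  ext D
  simp only [Set.mem_ofPred_eq]
  constructor
  · rintro ⟨hD, hS, -, h⟩
    exact ⟨hD, (hD.natDegree_eq_sum_count hS hm).trans h⟩
  · rintro ⟨hD, rfl⟩
    have hS : ∀ Q ∈ normalizedFactors D, Q ∈ monicIrreducibles Fq n := fun Q hQ =>
      mem_monicIrreducibles_of_mem_normalizedFactors hD.ne_zero hQ
        ((natDegree_le_of_dvd (dvd_of_mem_normalizedFactors hQ) hD.ne_zero).trans hk)
    have h := hD.natDegree_eq_sum_count hS hm
    refine ⟨hD, hS, fun Q hQ => Finset.mem_range_succ_iff.mpr (le_trans ?_ hk), h.symm⟩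
    rw [h]
    exact (Nat.le_mul_of_pos_right _ (hi Q hQ).natDegree_pos).trans
      (Finset.single_le_sum (f := fun Q => (normalizedFactors D).count Q * Q.natDegree)
        (fun _ _ => Nat.zero_le _) hQ)

open Classical in
theorem Polynomial.coeff_prod_eq_cubeFreeCount [Fintype Fq] [DecidableEq Fq] {B : Fq[X]}
    {n k : ℕ} (hk : k ≤ n) :
    (∏ Q ∈ monicIrreducibles Fq n,
      (if Q ∣ B then 1 else 1 + 2 * (X : ℝ[X]) ^ Q.natDegree)).coeff k = cubeFreeCount B k := by
  have hm : ∀ Q ∈ monicIrreducibles Fq n, Q.Monic := fun Q h => (mem_monicIrreducibles.mp h).1.1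
  have hi : ∀ Q ∈ monicIrreducibles Fq n, Irreducible Q := fun Q h => (mem_monicIrreducibles.mp h).2
  have key := coeff_prod_sum_X_pow _ hm hi
    (fun Q => if Q ∣ B then {0} else Finset.range 3) (fun j => min j 1) k
  have hfac : ∀ Q : Fq[X], ∑ j ∈ (if Q ∣ B then {0} else Finset.range 3),
      (X : ℝ[X]) ^ (min j 1 * Q.natDegree) =
      if Q ∣ B then 1 else 1 + 2 * (X : ℝ[X]) ^ Q.natDegree := by
    intro Q
    split_ifs
    · simp
    · simp [Finset.sum_range_succ]
      ring
  simp_rw [hfac] at key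
  rw [key, cubeFreeCount]
  congr 2
  ext D
  simp only [Set.mem_ofPred_eq]
  have hrad : ∀ S : Finset Fq[X], (∀ Q ∈ normalizedFactors D, Q ∈ S) →
      ∑ Q ∈ S, min ((normalizedFactors D).count Q) 1 * Q.natDegree = D.radDeg := by
    intro S hS
    rw [radDeg, ← Finset.sum_subset (s₁ := (normalizedFactors D).toFinset)]
    · refine Finset.sum_congr rfl fun Q hQ => ?_
      rw [Multiset.mem_toFinset, ← Multiset.one_le_count_iff_mem] at hQ
      rw [min_eq_right hQ, one_mul]
    · exact fun Q hQ => hS Q (Multiset.mem_toFinset.mp hQ)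
    · intro Q _ hQ
      rw [Multiset.mem_toFinset, ← Multiset.count_eq_zero] at hQ
      simp [hQ]
  have hcount : ∀ (j : ℕ) (Q : Fq[X]), D.Monic → Q.Monic → Irreducible Q →
      (j ≤ (normalizedFactors D).count Q ↔ Q ^ j ∣ D) := by
    intro j Q hD hQ hQi
    rw [Multiset.le_count_iff_replicate_le, dvd_iff_normalizedFactors_le_normalizedFactors
      (pow_ne_zero _ hQi.ne_zero) hD.ne_zero, hQi.normalizedFactors_pow, hQ.normalize_eq_self]
  constructor
  · rintro ⟨hD, hS, ht, h⟩
    refine ⟨hD, ?_, ?_, (hrad _ hS).symm.trans h⟩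
    · intro P hP hPi hdvd
      have h3 := (hcount 3 P hD hP hPi).mpr hdvd
      have hmem : P ∈ monicIrreducibles Fq n :=
        hS P (Multiset.count_pos.mp (by omega))
      have := ht P hmem
      split_ifs at this
      · rw [Finset.mem_singleton] at this
        omega
      · rw [Finset.mem_range] at this
        omega
    · refine isCoprime_of_irreducible_dvd (fun h => hD.ne_zero h.1) fun P hPi hPD hPB => ?_
      obtain ⟨Q, hQ, hPQ⟩ := exists_mem_normalizedFactors_of_dvd hD.ne_zero hPi hPD
      have := ht Q (hS Q hQ)
      rw [if_pos (hPQ.symm.dvd.trans hPB), Finset.mem_singleton, Multiset.count_eq_zero] at this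
      exact this hQ
  · rintro ⟨hD, hcf, hco, h⟩
    have hS : ∀ Q ∈ normalizedFactors D, Q ∈ monicIrreducibles Fq n := by
      intro Q hQ
      refine mem_monicIrreducibles_of_mem_normalizedFactors hD.ne_zero hQ (le_trans ?_ hk)
      rw [← h, radDeg]
      exact Finset.single_le_sum (f := natDegree) (fun _ _ => Nat.zero_le _)
        (Multiset.mem_toFinset.mpr hQ)
    refine ⟨hD, hS, fun Q hQ => ?_, (hrad _ hS).trans h⟩
    split_ifs with hQB
    · rw [Finset.mem_singleton, Multiset.count_eq_zero]
      intro hmem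
      exact (hi Q hQ).not_isUnit (hco.isUnit_of_dvd' (dvd_of_mem_normalizedFactors hmem) hQB)
    · rw [Finset.mem_range]
      by_contra! h3
      exact hcf Q (hm Q hQ) (hi Q hQ) ((hcount 3 Q hD (hm Q hQ) (hi Q hQ)).mp h3)

end Counting

section SecondDifference

open Filter Topology

/-- The coefficients of `(∑ N k X ^ k) * (1 - q X) ^ 2`. -/
def twistedSecondDiff (q : ℝ) (N : ℕ → ℝ) : ℕ → ℝ
  | 0 => N 0
  | 1 => N 1 - 2 * q * N 0
  | k + 2 => N (k + 2) - 2 * q * N (k + 1) + q ^ 2 * N k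

theorem Polynomial.coeff_mul_one_sub_sq {p : ℝ[X]} {q : ℝ} {N : ℕ → ℝ} {n : ℕ}
    (hp : ∀ k ≤ n, p.coeff k = N k) :
    ∀ k ≤ n, (p * (1 - C q * X) ^ 2).coeff k = twistedSecondDiff q N k := by
  have h : p * (1 - C q * X) ^ 2 = p - C (2 * q) * (p * X) + C (q ^ 2) * (p * X * X) := by
    simp only [C_mul, C_pow, C_ofNat]
    ring
  intro k hk
  rw [h]
  match k with
  | 0 => simp [twistedSecondDiff, hp 0 hk]
  | 1 =>
    simp [twistedSecondDiff, -map_mul, -map_pow, coeff_mul_X p 0, coeff_mul_X (p * X) 0,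
      hp 0 n.zero_le, hp 1 hk]
  | k + 2 =>
    simp [twistedSecondDiff, -map_mul, -map_pow, coeff_mul_X, hp k (by omega),
      hp (k + 1) (by omega), hp (k + 2) hk]

theorem sum_twistedSecondDiff {q : ℝ} (hq : q ≠ 0) (N : ℕ → ℝ) (d : ℕ) :
    ∑ k ∈ Finset.range (d + 2), twistedSecondDiff q N k / q ^ k =
      N (d + 1) / q ^ (d + 1) - N d / q ^ d := by
  induction d with
  | zero =>
    simp [Finset.sum_range_succ, twistedSecondDiff]
    field_simp
    ring
  | succ d ih =>
    rw [Finset.sum_range_succ, ih, twistedSecondDiff]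
    field_simp
    ring

theorem div_pow_eq_sum_twistedSecondDiff {q : ℝ} (hq : q ≠ 0) (N : ℕ → ℝ) (d : ℕ) :
    N d / q ^ d =
      ∑ k ∈ Finset.range (d + 1), ((d : ℝ) + 1 - k) * (twistedSecondDiff q N k / q ^ k) := by
  induction d with
  | zero => simp [twistedSecondDiff]
  | succ d ih =>
    have h := sum_twistedSecondDiff hq N d
    have hs : ∑ k ∈ Finset.range (d + 2),
        (((d + 1 : ℕ) : ℝ) + 1 - k) * (twistedSecondDiff q N k / q ^ k) =
        ∑ k ∈ Finset.range (d + 2), ((d : ℝ) + 1 - k) * (twistedSecondDiff q N k / q ^ k) +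
        ∑ k ∈ Finset.range (d + 2), twistedSecondDiff q N k / q ^ k := by
      rw [← Finset.sum_add_distrib]
      refine Finset.sum_congr rfl fun k _ => ?_
      push_cast
      ring
    rw [hs, h, Finset.sum_range_succ, ← ih]
    push_cast
    ring

/-- A convolution with `k + 1` of a geometrically decaying sequence is asymptotically affine. -/
theorem abs_sum_sub_affine_le {γ : ℕ → ℝ} {A ρ : ℝ} (hρ0 : 0 ≤ ρ) (hρ1 : ρ < 1)
    (hγ : ∀ k, |γ k| ≤ A * ρ ^ k) (d : ℕ) :
    |∑ k ∈ Finset.range (d + 1), ((d : ℝ) + 1 - k) * γ k -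
      ((∑' k, γ k) * d + ∑' k : ℕ, (1 - (k : ℝ)) * γ k)| ≤ A * ρ / (1 - ρ) ^ 2 * ρ * ρ ^ d := by
  have hnorm : ‖ρ‖ < 1 := by rwa [Real.norm_of_nonneg hρ0]
  have hs0 : Summable γ :=
    Summable.of_norm_bounded ((summable_geometric_of_lt_one hρ0 hρ1).mul_left A) hγ
  have hs1 : Summable fun k : ℕ => (k : ℝ) * γ k := by
    refine Summable.of_norm_bounded
      ((summable_pow_mul_geometric_of_norm_lt_one 1 hnorm).mul_left A) fun k => ?_
    rw [norm_mul, Real.norm_natCast, pow_one, mul_left_comm]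
    exact mul_le_mul_of_nonneg_left (hγ k) k.cast_nonneg
  have hs2 : Summable fun k : ℕ => (1 - (k : ℝ)) * γ k := by
    simpa only [sub_mul, one_mul] using hs0.sub hs1
  have hs3 : Summable fun k : ℕ => ((d : ℝ) + 1 - k) * γ k := by
    simpa only [sub_mul] using (hs0.mul_left ((d : ℝ) + 1)).sub hs1
  have heq : (∑' k, γ k) * d + ∑' k : ℕ, (1 - (k : ℝ)) * γ k =
      ∑' k : ℕ, ((d : ℝ) + 1 - k) * γ k := by
    rw [← tsum_mul_right, ← (hs0.mul_right _).tsum_add hs2]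
    exact tsum_congr fun k => by ring
  rw [heq, ← hs3.sum_add_tsum_nat_add (d + 1), sub_add_cancel_left, abs_neg, ← Real.norm_eq_abs]
  have hb := (hasSum_coe_mul_geometric_of_norm_lt_one hnorm).mul_left (A * ρ ^ (d + 1))
  refine (tsum_of_norm_bounded hb fun j => ?_).trans_eq (by ring)
  have hj : (d : ℝ) + 1 - ((j + (d + 1) : ℕ) : ℝ) = -j := by
    push_cast
    ring
  rw [hj, norm_mul, norm_neg, Real.norm_natCast, Real.norm_eq_abs]
  exact (mul_le_mul_of_nonneg_left (hγ _) j.cast_nonneg).trans_eq (by ring)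

theorem exists_affine_asymptotic {q : ℝ} (hq : 1 < q) (N : ℕ → ℝ) (G : ℕ → ℝ[X])
    (hG : ∀ n, ∀ k ≤ n, (G n).coeff k = twistedSecondDiff q N k)
    (hbound : ∀ r : ℝ, 0 < r → r ≤ 1 → q * r ^ 2 < 1 →
      ∃ A, ∀ n k, |(G n).coeff k| * r ^ k ≤ A)
    (hpos : ∃ c > 0, ∀ n, c ≤ (G n).eval q⁻¹) :
    ∃ a : ℝ, 0 < a ∧ ∃ b : ℝ, ∀ ε : ℝ, 0 < ε → ∃ C : ℝ, ∀ d : ℕ,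
      |N d - (a * d + b) * q ^ d| ≤ C * q ^ ((1 / 2 + ε) * d) := by
  have hq0 : 0 < q := by linarith
  set γ : ℕ → ℝ := fun k => twistedSecondDiff q N k / q ^ k with hγ
  have hdecay : ∀ δ : ℝ, 0 < δ → ∃ A, ∀ n k,
      |(G n).coeff k / q ^ k| ≤ A * (q ^ (δ - 1 / 2)) ^ k := by
    intro δ hδ
    obtain ⟨A, hA⟩ := hbound (q ^ (-(1 / 2 + δ))) (by positivity)
      (Real.rpow_le_one_of_one_le_of_nonpos hq.le (by linarith)) (by
        rw [← Real.rpow_natCast, ← Real.rpow_mul hq0.le]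
        nth_rewrite 1 [← Real.rpow_one q]
        rw [← Real.rpow_add hq0]
        exact Real.rpow_lt_one_of_one_lt_of_neg hq (by push_cast; linarith))
    refine ⟨A, fun n k => ?_⟩
    have hr : q ^ (δ - 1 / 2) * (q * q ^ (-(1 / 2 + δ))) = 1 := by
      nth_rewrite 2 [← Real.rpow_one q]
      rw [← Real.rpow_add hq0, ← Real.rpow_add hq0]
      ring_nf
      exact Real.rpow_zero q
    rw [abs_div, abs_of_pos (pow_pos hq0 k), div_le_iff₀ (pow_pos hq0 k)]
    refine le_of_mul_le_mul_right ?_ (pow_pos (Real.rpow_pos_of_pos hq0 (-(1 / 2 + δ))) k)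
    refine (hA n k).trans_eq ?_
    rw [mul_assoc, mul_assoc, ← mul_pow, ← mul_pow, hr, one_pow, mul_one]
  have hγdecay : ∀ δ : ℝ, 0 < δ → ∃ A, ∀ k, |γ k| ≤ A * (q ^ (δ - 1 / 2)) ^ k := by
    intro δ hδ
    obtain ⟨A, hA⟩ := hdecay δ hδ
    refine ⟨A, fun k => ?_⟩
    simp only [hγ, ← hG k k le_rfl]
    exact hA k k
  refine ⟨∑' k, γ k, ?_, ∑' k : ℕ, (1 - (k : ℝ)) * γ k, ?_⟩
  · obtain ⟨c, hc, hcG⟩ := hpos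
    obtain ⟨A, hA⟩ := hdecay (1 / 4) (by norm_num)
    have hlim : Tendsto (fun n => ∑' k, (G n).coeff k / q ^ k) atTop (𝓝 (∑' k, γ k)) := by
      refine tendsto_tsum_of_dominated_convergence
        (bound := fun k => A * (q ^ ((1 / 4 : ℝ) - 1 / 2)) ^ k) ?_ ?_ ?_
      · exact (summable_geometric_of_lt_one (by positivity)
          (Real.rpow_lt_one_of_one_lt_of_neg hq (by norm_num))).mul_left A
      · intro k
        refine tendsto_const_nhds.congr' ?_
        filter_upwards [eventually_ge_atTop k] with n hn
        simp only [hγ, hG n k hn]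
      · exact Eventually.of_forall fun n k => hA n k
    refine hc.trans_le (ge_of_tendsto' hlim fun n => (hcG n).trans_eq ?_)
    rw [eval_eq_sum_range, tsum_eq_sum (s := Finset.range ((G n).natDegree + 1))]
    · exact Finset.sum_congr rfl fun k _ => by rw [inv_pow, div_eq_mul_inv]
    · intro k hk
      rw [coeff_eq_zero_of_natDegree_lt (by
        rwa [Finset.mem_range, not_lt, Nat.add_one_le_iff] at hk), zero_div]
  · intro ε hε
    set δ : ℝ := min ε (1 / 4) with hδ
    have hδ0 : 0 < δ := lt_min hε (by norm_num)
    have hδ4 : δ ≤ 1 / 4 := min_le_right _ _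
    obtain ⟨A, hA⟩ := hγdecay δ hδ0
    set ρ := q ^ (δ - 1 / 2) with hρ
    have hρ0 : 0 ≤ ρ := by positivity
    have hρ1 : ρ < 1 := Real.rpow_lt_one_of_one_lt_of_neg hq (by linarith)
    have hA0 : 0 ≤ A := by simpa using (abs_nonneg _).trans (hA 0)
    refine ⟨A * ρ / (1 - ρ) ^ 2 * ρ, fun d => ?_⟩
    have h := abs_sum_sub_affine_le hρ0 hρ1 hA d
    rw [← div_pow_eq_sum_twistedSecondDiff hq0.ne'] at h
    have hqd : 0 < q ^ d := pow_pos hq0 d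
    have hsplit : N d - ((∑' k, γ k) * d + ∑' k : ℕ, (1 - (k : ℝ)) * γ k) * q ^ d =
        (N d / q ^ d - ((∑' k, γ k) * d + ∑' k : ℕ, (1 - (k : ℝ)) * γ k)) * q ^ d := by
      field_simp
    rw [hsplit, abs_mul, abs_of_pos hqd]
    refine (mul_le_mul_of_nonneg_right h hqd.le).trans ?_
    rw [mul_assoc]
    refine mul_le_mul_of_nonneg_left ?_ (by positivity)
    rw [hρ, ← Real.rpow_mul_natCast hq0.le, ← Real.rpow_natCast q d, ← Real.rpow_add hq0]
    refine Real.rpow_le_rpow_of_exponent_le hq.le ?_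
    have : δ * d ≤ ε * d := mul_le_mul_of_nonneg_right (min_le_left _ _) d.cast_nonneg
    linarith

end SecondDifference

section EulerFactors

/-- Coefficientwise majorization is compatible with finite products. -/
theorem Polynomial.abs_coeff_prod_le {ι : Type*} (s : Finset ι) {p P : ι → ℝ[X]}
    (h : ∀ i ∈ s, ∀ k, |(p i).coeff k| ≤ (P i).coeff k) (k : ℕ) :
    |(∏ i ∈ s, p i).coeff k| ≤ (∏ i ∈ s, P i).coeff k := by
  classical
  induction s using Finset.induction_on generalizing k with
  | empty =>
    simp only [Finset.prod_empty, coeff_one]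
    split_ifs <;> simp
  | insert a s ha ih =>
    rw [Finset.prod_insert ha, Finset.prod_insert ha, coeff_mul, coeff_mul]
    refine (Finset.abs_sum_le_sum_abs _ _).trans (Finset.sum_le_sum fun x _ => ?_)
    rw [abs_mul]
    have h1 := h a (Finset.mem_insert_self a s) x.1
    exact mul_le_mul h1 (ih (fun i hi => h i (Finset.mem_insert_of_mem hi)) x.2)
      (abs_nonneg _) ((abs_nonneg _).trans h1)

theorem Polynomial.coeff_mul_pow_le_eval {P : ℝ[X]} (hP : ∀ k, 0 ≤ P.coeff k) {r : ℝ}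
    (hr : 0 ≤ r) (k : ℕ) : P.coeff k * r ^ k ≤ P.eval r := by
  have hnn : ∀ j, 0 ≤ P.coeff j * r ^ j := fun j => mul_nonneg (hP j) (pow_nonneg hr j)
  rw [eval_eq_sum_range]
  by_cases hk : k ≤ P.natDegree
  · exact Finset.single_le_sum (f := fun j => P.coeff j * r ^ j) (fun j _ => hnn j)
      (Finset.mem_range_succ_iff.mpr hk)
  · rw [coeff_eq_zero_of_natDegree_lt (not_le.mp hk), zero_mul]
    exact Finset.sum_nonneg fun j _ => hnn j

variable {Fq : Type*} [Field Fq]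

theorem Polynomial.sum_pow_natDegree_monicIrreducibles_le [Fintype Fq] {s : ℝ} (hs : 0 ≤ s)
    (hqs : Fintype.card Fq * s < 1) (n : ℕ) :
    ∑ Q ∈ monicIrreducibles Fq n, s ^ Q.natDegree ≤ (1 - Fintype.card Fq * s)⁻¹ := by
  classical
  have hqs0 : 0 ≤ Fintype.card Fq * s := by positivity
  rw [← Finset.sum_fiberwise_of_maps_to (t := Finset.range (n + 1)) (g := natDegree)
    fun Q hQ => Finset.mem_range_succ_iff.mpr (mem_monicIrreducibles.mp hQ).1.2,
    ← tsum_geometric_of_lt_one hqs0 hqs]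
  refine le_trans (Finset.sum_le_sum fun m _ => ?_)
    ((summable_geometric_of_lt_one hqs0 hqs).sum_le_tsum (Finset.range (n + 1))
      fun m _ => pow_nonneg hqs0 m)
  rw [Finset.sum_congr rfl (g := fun _ => s ^ m) fun Q hQ => by rw [(Finset.mem_filter.mp hQ).2],
    Finset.sum_const, nsmul_eq_mul, mul_pow]
  refine mul_le_mul_of_nonneg_right ?_ (pow_nonneg hs m)
  rw [← Nat.cast_pow, Nat.cast_le, ← ncard_monic_natDegree_eq, ← Set.ncard_coe_finset]
  refine Set.ncard_le_ncard (fun Q hQ => ?_) (finite_monic_natDegree_eq m)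
  rw [Finset.mem_coe, Finset.mem_filter, mem_monicIrreducibles] at hQ
  exact ⟨hQ.1.1.1, hQ.2⟩

open Classical in
theorem Polynomial.card_filter_dvd_monicIrreducibles_le [Finite Fq] {B : Fq[X]} (hB : B ≠ 0)
    (n : ℕ) :
    ((monicIrreducibles Fq n).filter (· ∣ B)).card ≤ (normalizedFactors B).toFinset.card := by
  refine Finset.card_le_card fun Q hQ => ?_
  rw [Finset.mem_filter, mem_monicIrreducibles] at hQ
  rw [Multiset.mem_toFinset, Polynomial.mem_normalizedFactors_iff hB]
  exact ⟨hQ.1.2, hQ.1.1.1, hQ.2⟩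

theorem Polynomial.X_pow_dvd_prod_one_sub [Fintype Fq] (n : ℕ) :
    (X : ℝ[X]) ^ (n + 1) ∣ ∏ Q ∈ monicIrreducibles Fq n, (1 - (X : ℝ[X]) ^ Q.natDegree) -
      (1 - C (Fintype.card Fq : ℝ) * X) := by
  set E := ∏ Q ∈ monicIrreducibles Fq n, (1 - (X : ℝ[X]) ^ Q.natDegree) with hE
  set Z := ∏ Q ∈ monicIrreducibles Fq n,
    ∑ j ∈ Finset.range (n + 1), (X : ℝ[X]) ^ (j * Q.natDegree) with hZ
  have hZE : (X : ℝ[X]) ^ (n + 1) ∣ Z * E - 1 := by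
    rw [hZ, hE, ← Finset.prod_mul_distrib]
    refine Finset.prod_induction _ (fun p : ℝ[X] => X ^ (n + 1) ∣ p - 1) ?_ (by simp) ?_
    · intro p p' hp hp'
      have : p * p' - 1 = (p - 1) * p' + (p' - 1) := by ring
      rw [this]
      exact (hp.mul_right _).add hp'
    · intro Q hQ
      have hd := (mem_monicIrreducibles.mp hQ).2.natDegree_pos
      simp_rw [mul_comm _ Q.natDegree, pow_mul]
      rw [geom_sum_mul_neg, sub_sub_cancel_left, dvd_neg, ← pow_mul]
      exact pow_dvd_pow _ (Nat.le_mul_of_pos_left _ hd)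
  have hZq : (X : ℝ[X]) ^ (n + 1) ∣ Z * (1 - C (Fintype.card Fq : ℝ) * X) - 1 := by
    rw [X_pow_dvd_iff]
    intro k hk
    have hZk : ∀ k ≤ n, Z.coeff k = (Fintype.card Fq : ℝ) ^ k := fun k hk =>
      coeff_prod_geom_monicIrreducibles hk
    have : Z * (1 - C (Fintype.card Fq : ℝ) * X) - 1 =
        Z - C (Fintype.card Fq : ℝ) * (Z * X) - 1 := by ring
    rw [this, coeff_sub, coeff_sub, coeff_C_mul, hZk k (by omega)]
    match k with
    | 0 => simp
    | k + 1 =>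
      rw [coeff_mul_X, hZk k (by omega), coeff_one, if_neg (by omega)]
      ring
  have : E - (1 - C (Fintype.card Fq : ℝ) * X) =
      (Z * E - 1) * (1 - C (Fintype.card Fq : ℝ) * X) -
        (Z * (1 - C (Fintype.card Fq : ℝ) * X) - 1) * E := by ring
  rw [this]
  exact (hZE.mul_right _).sub (hZq.mul_right _)

open Classical in
/-- The Euler factor at `Q` of `(∑ N_d(B) X ^ d) * (1 - q X) ^ 2`. -/
noncomputable def cubeFreeEulerFactor (B Q : Fq[X]) : ℝ[X] :=
  (if Q ∣ B then 1 else 1 + 2 * X ^ Q.natDegree) * (1 - X ^ Q.natDegree) ^ 2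

theorem coeff_prod_cubeFreeEulerFactor [Fintype Fq] [DecidableEq Fq] (B : Fq[X]) (n : ℕ) :
    ∀ k ≤ n, (∏ Q ∈ monicIrreducibles Fq n, cubeFreeEulerFactor B Q).coeff k =
      twistedSecondDiff (Fintype.card Fq) (fun d => cubeFreeCount B d) k := by
  classical
  intro k hk
  rw [← coeff_mul_one_sub_sq (fun k hk => coeff_prod_eq_cubeFreeCount (B := B) hk) k hk,
    ← sub_eq_zero, ← coeff_sub]
  refine X_pow_dvd_iff.mp ?_ k (Nat.lt_succ_of_le hk)
  simp_rw [cubeFreeEulerFactor]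
  rw [Finset.prod_mul_distrib, ← mul_sub, Finset.prod_pow]
  exact ((X_pow_dvd_prod_one_sub n).trans (sub_dvd_pow_sub_pow _ _ 2)).mul_left _

open Classical in
theorem abs_coeff_cubeFreeEulerFactor_le (B Q : Fq[X]) (k : ℕ) :
    |(cubeFreeEulerFactor B Q).coeff k| ≤
      (if Q ∣ B then 1 + 2 * X ^ Q.natDegree + X ^ (2 * Q.natDegree)
        else 1 + 3 * X ^ (2 * Q.natDegree) + 2 * X ^ (3 * Q.natDegree) : ℝ[X]).coeff k := by
  rw [cubeFreeEulerFactor]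
  split_ifs
  · have : (1 * (1 - X ^ Q.natDegree) ^ 2 : ℝ[X]) =
        1 - 2 * X ^ Q.natDegree + X ^ (2 * Q.natDegree) := by ring
    rw [this]
    simp only [coeff_add, coeff_sub, coeff_ofNat_mul, coeff_one, coeff_X_pow]
    split_ifs <;> norm_num
  · have : ((1 + 2 * X ^ Q.natDegree) * (1 - X ^ Q.natDegree) ^ 2 : ℝ[X]) =
        1 - 3 * X ^ (2 * Q.natDegree) + 2 * X ^ (3 * Q.natDegree) := by ring
    rw [this]
    simp only [coeff_add, coeff_sub, coeff_ofNat_mul, coeff_one, coeff_X_pow]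
    split_ifs <;> norm_num

theorem exists_abs_coeff_prod_cubeFreeEulerFactor_le [Fintype Fq] {B : Fq[X]} (hB : B ≠ 0)
    {r : ℝ} (hr0 : 0 < r) (hr1 : r ≤ 1) (hqr : Fintype.card Fq * r ^ 2 < 1) :
    ∃ A, ∀ n k,
      |(∏ Q ∈ monicIrreducibles Fq n, cubeFreeEulerFactor B Q).coeff k| * r ^ k ≤ A := by
  classical
  refine ⟨4 ^ (normalizedFactors B).toFinset.card *
    Real.exp (5 * (1 - Fintype.card Fq * r ^ 2)⁻¹), fun n k => ?_⟩
  have hmaj := abs_coeff_prod_le (monicIrreducibles Fq n)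
    fun Q _ => abs_coeff_cubeFreeEulerFactor_le B Q
  refine (mul_le_mul_of_nonneg_right (hmaj k) (pow_nonneg hr0.le k)).trans
    ((coeff_mul_pow_le_eval (fun j => (abs_nonneg _).trans (hmaj j)) hr0.le k).trans ?_)
  rw [eval_prod]
  have hfac : ∀ Q : Fq[X], 0 ≤ eval r (if Q ∣ B then
        1 + 2 * X ^ Q.natDegree + X ^ (2 * Q.natDegree)
        else 1 + 3 * X ^ (2 * Q.natDegree) + 2 * X ^ (3 * Q.natDegree) : ℝ[X]) ∧
      eval r (if Q ∣ B then 1 + 2 * X ^ Q.natDegree + X ^ (2 * Q.natDegree)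
        else 1 + 3 * X ^ (2 * Q.natDegree) + 2 * X ^ (3 * Q.natDegree) : ℝ[X]) ≤
      (if Q ∣ B then 4 else 1) * Real.exp (5 * (r ^ 2) ^ Q.natDegree) := by
    intro Q
    have h1 : r ^ Q.natDegree ≤ 1 := pow_le_one₀ hr0.le hr1
    have h2 : r ^ (2 * Q.natDegree) ≤ 1 := pow_le_one₀ hr0.le hr1
    have h3 : r ^ (3 * Q.natDegree) ≤ r ^ (2 * Q.natDegree) :=
      pow_le_pow_of_le_one hr0.le hr1 (by omega)
    have h4 := Real.add_one_le_exp (5 * (r ^ 2) ^ Q.natDegree)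
    have h5 : 1 ≤ Real.exp (5 * (r ^ 2) ^ Q.natDegree) := Real.one_le_exp (by positivity)
    rw [← pow_mul] at h4 h5 ⊢
    split_ifs
    · simp only [eval_add, eval_mul, eval_one, eval_ofNat, eval_pow, eval_X]
      exact ⟨by positivity, by linarith⟩
    · simp only [eval_add, eval_mul, eval_one, eval_ofNat, eval_pow, eval_X]
      exact ⟨by positivity, by linarith⟩
  refine (Finset.prod_le_prod (fun Q _ => (hfac Q).1) fun Q _ => (hfac Q).2).trans ?_
  rw [Finset.prod_mul_distrib, ← Real.exp_sum, ← Finset.mul_sum, Finset.prod_ite,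
    Finset.prod_const, Finset.prod_const_one, mul_one]
  have hcard := card_filter_dvd_monicIrreducibles_le hB n
  have hsum := sum_pow_natDegree_monicIrreducibles_le (sq_nonneg r) hqr n
  gcongr
  norm_num

theorem exp_neg_le_one_sub_of_le_half {x : ℝ} (hx0 : 0 ≤ x) (hx : x ≤ 1 / 2) :
    Real.exp (-6 * x ^ 2) ≤ (1 + 2 * x) * (1 - x) ^ 2 := by
  have h1 : 1 + 6 * x ^ 2 ≤ Real.exp (6 * x ^ 2) := by
    linarith [Real.add_one_le_exp (6 * x ^ 2)]
  have h2 : 1 ≤ (1 + 2 * x) * (1 - x) ^ 2 * (1 + 6 * x ^ 2) := by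
    have h3 : 0 ≤ 3 + 2 * x - 18 * x ^ 2 + 12 * x ^ 3 := by
      have h4 : 0 ≤ x * (3 - 2 * x) * (1 / 2 - x) :=
        mul_nonneg (mul_nonneg hx0 (by linarith)) (by linarith)
      nlinarith [sq_nonneg (12 * x - 7)]
    linarith [mul_nonneg (sq_nonneg x) h3]
  have hf : 0 ≤ (1 + 2 * x) * (1 - x) ^ 2 := by positivity
  rw [neg_mul, Real.exp_neg, inv_le_iff_one_le_mul₀ (Real.exp_pos _)]
  exact h2.trans (mul_le_mul_of_nonneg_left h1 hf)

theorem exists_le_eval_prod_cubeFreeEulerFactor [Fintype Fq] {B : Fq[X]} (hB : B ≠ 0) :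
    ∃ c > 0, ∀ n,
      c ≤ (∏ Q ∈ monicIrreducibles Fq n, cubeFreeEulerFactor B Q).eval (Fintype.card Fq : ℝ)⁻¹ := by
  classical
  have hq : (2 : ℝ) ≤ Fintype.card Fq := by exact_mod_cast Fintype.one_lt_card (α := Fq)
  set x : ℝ := (Fintype.card Fq : ℝ)⁻¹ with hx
  have hx0 : 0 ≤ x := by positivity
  have hx2 : x ≤ 1 / 2 := by
    rw [hx, one_div]
    exact inv_anti₀ two_pos hq
  have hqx : Fintype.card Fq * x ^ 2 < 1 := by
    rw [sq, ← mul_assoc, hx, mul_inv_cancel₀ (by linarith), one_mul]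
    linarith
  refine ⟨(1 / 4) ^ (normalizedFactors B).toFinset.card *
    Real.exp (-6 * (1 - Fintype.card Fq * x ^ 2)⁻¹), by positivity, fun n => ?_⟩
  have hfac : ∀ Q ∈ monicIrreducibles Fq n,
      (if Q ∣ B then 1 / 4 else 1) * Real.exp (-6 * (x ^ 2) ^ Q.natDegree) ≤
        (cubeFreeEulerFactor B Q).eval x := by
    intro Q hQ
    have hd := (mem_monicIrreducibles.mp hQ).2.natDegree_pos
    have h0 : 0 ≤ x ^ Q.natDegree := pow_nonneg hx0 _
    have h1 : x ^ Q.natDegree ≤ 1 / 2 :=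
      (pow_le_of_le_one hx0 (by linarith) hd.ne').trans hx2
    rw [← pow_mul, mul_comm 2, pow_mul, cubeFreeEulerFactor]
    split_ifs
    · simp only [eval_mul, eval_sub, eval_one, eval_pow, eval_X]
      have : Real.exp (-6 * (x ^ Q.natDegree) ^ 2) ≤ 1 := Real.exp_le_one_iff.mpr (by
        nlinarith [sq_nonneg (x ^ Q.natDegree)])
      nlinarith
    · simp only [eval_add, eval_mul, eval_sub, eval_one, eval_ofNat, eval_pow, eval_X]
      rw [one_mul]
      exact exp_neg_le_one_sub_of_le_half h0 h1
  rw [eval_prod]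
  refine le_trans ?_ (Finset.prod_le_prod (fun Q _ => ?_) hfac)
  · rw [Finset.prod_mul_distrib, ← Real.exp_sum, ← Finset.mul_sum, Finset.prod_ite,
      Finset.prod_const, Finset.prod_const_one, mul_one]
    have hcard := card_filter_dvd_monicIrreducibles_le hB n
    have hsum := sum_pow_natDegree_monicIrreducibles_le (sq_nonneg x) hqx n
    refine mul_le_mul ?_ (Real.exp_le_exp.mpr (by linarith)) (Real.exp_pos _).le (by positivity)
    exact pow_le_pow_of_le_one (by norm_num) (by norm_num) hcard
  · split_ifs <;> positivity

end EulerFactors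

/-- The first assertion of Lemma 4.5 of the paper: there are `a > 0` and `b` such that
`N_d(B) = (a·d + b)·q^d + O_ε(q^{(1/2+ε)d})` for every `ε > 0`. -/
theorem cubefree_radical_degree_count_asymptotic
    (Fq : Type*) [Field Fq] [Fintype Fq] [DecidableEq Fq]
    (B : Fq[X]) (hB : B ≠ 0) :
    ∃ a : ℝ, 0 < a ∧ ∃ b : ℝ, ∀ ε : ℝ, 0 < ε → ∃ C : ℝ, ∀ d : ℕ,
      |(cubeFreeCount B d : ℝ) - (a * d + b) * (Fintype.card Fq : ℝ) ^ d| ≤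
        C * (Fintype.card Fq : ℝ) ^ ((1 / 2 + ε) * d) := by
  refine exists_affine_asymptotic (by exact_mod_cast Fintype.one_lt_card (α := Fq))
    (fun d => (cubeFreeCount B d : ℝ))
    (fun n => ∏ Q ∈ monicIrreducibles Fq n, cubeFreeEulerFactor B Q)
    (coeff_prod_cubeFreeEulerFactor B) (fun r hr0 hr1 hqr => ?_) ?_
  · exact exists_abs_coeff_prod_cubeFreeEulerFactor_le hB hr0 hr1 hqr
  · exact exists_le_eval_prod_cubeFreeEulerFactor hB
end
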